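/- arXiv:2104.04372 — 3 statements merged into one kernel-verified Lean document; each statement's English description precedes it below -/
import Mathlib

section
/- There exist h₀, ε₀ > 0, depending only on the constants in the stated assumptions, such that for all 0 < h < h₀ and 0 < ε < ε₀ with ε/h ≤ 1 the following holds: for every μ ∈ 𝒫₂^r(ℝ^d) with 𝓕(μ) < ∞ and H(μ) < ∞ there exists a unique ν* ∈ 𝒫₂^r(ℝ^d) minimising ν ↦ (1/2h) W_{c_h,ε}(μ,ν) + 𝓕(ν) over 𝒫₂^r(ℝ^d); that is, (1/2h) W_{c_h,ε}(μ,ν*) + 𝓕(ν*) ≤ (1/2h) W_{c_h,ε}(μ,ν) + 𝓕(ν) for all ν ∈ 𝒫₂^r(ℝ^d), with equality only for ν = ν*. -/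
open MeasureTheory Filter
open scoped ENNReal NNReal RealInnerProductSpace Topology Classical

noncomputable section

/-- `ℝ^d` with the Euclidean norm. -/
abbrev Euc (d : ℕ) : Type := EuclideanSpace ℝ (Fin d)

/-- Second moment `M(ρ) = ∫ ‖x‖² dρ`. -/
def M2 {α : Type*} [NormedAddCommGroup α] [MeasurableSpace α] (ρ : Measure α) : ℝ≥0∞ :=
  ∫⁻ x, (‖x‖₊ : ℝ≥0∞) ^ 2 ∂ρ

/-- `𝒫₂`: probability measures with finite second moment. -/
def IsP2 {α : Type*} [NormedAddCommGroup α] [MeasurableSpace α] (ρ : Measure α) : Prop :=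
  IsProbabilityMeasure ρ ∧ M2 ρ < ⊤

/-- the density of a measure w.r.t. the reference (Lebesgue) measure. -/
def dens {α : Type*} [MeasureSpace α] (ρ : Measure α) (x : α) : ℝ :=
  (ρ.rnDeriv volume x).toReal

/-- `𝒫₂^r`: absolutely continuous members of `𝒫₂`. -/
def IsP2r {α : Type*} [NormedAddCommGroup α] [MeasureSpace α] (ρ : Measure α) : Prop :=
  IsP2 ρ ∧ ρ ≪ (volume : Measure α)

/-- (negative Boltzmann) entropy `H(ρ) = ∫ ρ log ρ` if `ρ` is absolutely continuous
(`+∞` otherwise). -/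
def entropy {α : Type*} [MeasureSpace α] (ρ : Measure α) : EReal :=
  if ρ ≪ (volume : Measure α) ∧
      Integrable (fun x => dens ρ x * Real.log (dens ρ x)) (volume : Measure α)
  then ((∫ x, dens ρ x * Real.log (dens ρ x) ∂(volume : Measure α) : ℝ) : EReal)
  else ⊤

/-- `γ` is a coupling (transport plan) between `μ` and `ν`. -/
def IsCoupling {α : Type*} [MeasurableSpace α] (γ : Measure (α × α)) (μ ν : Measure α) : Prop :=
  γ.fst = μ ∧ γ.snd = ν

/-- `(c, γ) = ∫ c dγ` for a nonnegative cost. -/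
def costInt {α : Type*} [MeasurableSpace α] (c : α × α → ℝ) (γ : Measure (α × α)) : ℝ≥0∞ :=
  ∫⁻ p, ENNReal.ofReal (c p) ∂γ

/-- entropic regularised optimal transport cost `W_{c,ε}`. -/
def transportCost {α : Type*} [MeasureSpace α] (c : α × α → ℝ) (ε : ℝ)
    (μ ν : Measure α) : EReal :=
  ⨅ γ ∈ {γ : Measure (α × α) | IsCoupling γ μ ν},
    ((costInt c γ : EReal) + (ε : EReal) * entropy γ)

/-- potential part of the free energy, `F(ρ) = ∫ f dρ` (`f ≥ 0`). -/
def potentialEnergy {α : Type*} [MeasurableSpace α] (f : α → ℝ) (ρ : Measure α) : EReal :=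
  ((∫⁻ x, ENNReal.ofReal (f x) ∂ρ : ℝ≥0∞) : EReal)

/-- internal part of the free energy, `U(ρ) = ∫ u(ρ(x)) dx` (`+∞` if not a.c.). -/
def internalEnergy {α : Type*} [MeasureSpace α] (u : ℝ → ℝ) (ρ : Measure α) : EReal :=
  if ρ ≪ (volume : Measure α) ∧ Integrable (fun x => u (dens ρ x)) (volume : Measure α)
  then ((∫ x, u (dens ρ x) ∂(volume : Measure α) : ℝ) : EReal)
  else ⊤

/-- free energy `𝓕(ρ) = ∫ f dρ + ∫ u(ρ) dx`. -/
def freeEnergy {α : Type*} [MeasureSpace α] (f : α → ℝ) (u : ℝ → ℝ) (ρ : Measure α) : EReal :=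
  potentialEnergy f ρ + internalEnergy u ρ

/-- the JKO functional `ν ↦ (1/2h) W_{c,ε}(μ,ν) + 𝓕(ν)`. -/
def JKO {α : Type*} [MeasureSpace α] (c : α × α → ℝ) (h ε : ℝ) (f : α → ℝ) (u : ℝ → ℝ)
    (μ ν : Measure α) : EReal :=
  ((1 / (2 * h) : ℝ) : EReal) * transportCost c ε μ ν + freeEnergy f u ν

/-- divergence of a vector field (trace of the Jacobian). -/
def divg {d : ℕ} (F : Euc d → Euc d) (x : Euc d) : ℝ :=
  LinearMap.trace ℝ (Euc d) (fderiv ℝ F x).toLinearMap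

/-- the pressure `p(s) = u'(s) s - u(s)`. -/
def press (u : ℝ → ℝ) (s : ℝ) : ℝ := deriv u s * s - u s

/-- weak convergence of measures (against bounded continuous functions). -/
def WeakTendsto {α : Type*} [TopologicalSpace α] [MeasurableSpace α]
    (μs : ℕ → Measure α) (μ : Measure α) : Prop :=
  ∀ g : BoundedContinuousFunction α ℝ,
    Tendsto (fun k => ∫ x, g x ∂(μs k)) atTop (nhds (∫ x, g x ∂μ))

section StrongConvexMinimization

variable {X Y : Type*} [MeasurableSpace X] [MeasurableSpace Y]

/-- The second marginal of a density on a product space. -/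
def marginalSnd (mX : Measure X) (g : X × Y → ℝ) (y : Y) : ℝ := ∫ x, g (x, y) ∂mX

/-- An integral functional of a joint density and of its second marginal. -/
def jointFunctional (mX : Measure X) (mY : Measure Y) (E₁ : X × Y → ℝ → ℝ≥0∞)
    (E₂ : Y → ℝ → ℝ≥0∞) (g : X × Y → ℝ) : ℝ≥0∞ :=
  ∫⁻ p, E₁ p (g p) ∂(mX.prod mY) + ∫⁻ y, E₂ y (marginalSnd mX g y) ∂mY

/-- Nonnegative densities on a product space whose first marginal is `μ`. -/
structure IsPlanDensity (mX : Measure X) (mY : Measure Y) (μ : Measure X)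
    (g : X × Y → ℝ) : Prop where
  measurable : Measurable g
  nonneg : ∀ p, 0 ≤ g p
  fst_eq : ((mX.prod mY).withDensity fun p => ENNReal.ofReal (g p)).fst = μ

variable {mX : Measure X} {mY : Measure Y}

lemma measurable_marginalSnd [SFinite mX] {g : X × Y → ℝ} (hg : Measurable g) :
    Measurable (marginalSnd mX g) :=
  hg.stronglyMeasurable.integral_prod_left'.measurable

namespace IsPlanDensity

variable {μ : Measure X} {g g₁ g₂ : X × Y → ℝ}

lemma lintegral_ofReal (hg : IsPlanDensity mX mY μ g) :
    ∫⁻ p, ENNReal.ofReal (g p) ∂(mX.prod mY) = μ Set.univ := by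
  rw [← hg.fst_eq, Measure.fst_univ, withDensity_apply _ MeasurableSet.univ,
    Measure.restrict_univ]

lemma integrable [IsFiniteMeasure μ] (hg : IsPlanDensity mX mY μ g) :
    Integrable g (mX.prod mY) := by
  refine ⟨hg.measurable.aestronglyMeasurable, ?_⟩
  rw [hasFiniteIntegral_iff_ofReal (Eventually.of_forall hg.nonneg), hg.lintegral_ofReal]
  exact measure_lt_top _ _

lemma midpoint (h₁ : IsPlanDensity mX mY μ g₁) (h₂ : IsPlanDensity mX mY μ g₂) :
    IsPlanDensity mX mY μ fun p => (g₁ p + g₂ p) / 2 := by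
  refine ⟨(h₁.measurable.add h₂.measurable).div_const 2,
    fun p => div_nonneg (add_nonneg (h₁.nonneg p) (h₂.nonneg p)) (by norm_num), ?_⟩
  have key : ∀ p, ENNReal.ofReal ((g₁ p + g₂ p) / 2) =
      (2 : ℝ≥0∞)⁻¹ * (ENNReal.ofReal (g₁ p) + ENNReal.ofReal (g₂ p)) := fun p => by
    rw [ENNReal.ofReal_div_of_pos (by norm_num), ENNReal.ofReal_add (h₁.nonneg p) (h₂.nonneg p),
      ENNReal.div_eq_inv_mul]
    simp
  ext s hs
  have e₁ := congrArg (fun ρ => ρ s) h₁.fst_eq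
  have e₂ := congrArg (fun ρ => ρ s) h₂.fst_eq
  simp only [Measure.fst_apply hs, withDensity_apply _ (measurable_fst hs)] at e₁ e₂ ⊢
  simp_rw [key]
  have hsum : Measurable fun p => ENNReal.ofReal (g₁ p) + ENNReal.ofReal (g₂ p) :=
    h₁.measurable.ennreal_ofReal.add h₂.measurable.ennreal_ofReal
  rw [lintegral_const_mul _ hsum, lintegral_add_left h₁.measurable.ennreal_ofReal, e₁, e₂,
    ← two_mul, ← mul_assoc,
    ENNReal.inv_mul_cancel (by norm_num) (by norm_num), one_mul]

lemma of_tendsto [IsFiniteMeasure μ] {G : ℕ → X × Y → ℝ}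
    (hG : ∀ n, IsPlanDensity mX mY μ (G n)) (hgm : Measurable g) (hg0 : ∀ p, 0 ≤ g p)
    (hlim : Tendsto (fun n => ∫⁻ p, ‖G n p - g p‖ₑ ∂(mX.prod mY)) atTop (𝓝 0)) :
    IsPlanDensity mX mY μ g := by
  refine ⟨hgm, hg0, ?_⟩
  ext s hs
  have hms : MeasurableSet (Prod.fst ⁻¹' s : Set (X × Y)) := measurable_fst hs
  have e : ∀ n, ∫⁻ p in Prod.fst ⁻¹' s, ENNReal.ofReal (G n p) ∂(mX.prod mY) = μ s := fun n => by
    have := congrArg (fun ρ => ρ s) (hG n).fst_eq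
    simpa only [Measure.fst_apply hs, withDensity_apply _ hms] using this
  rw [Measure.fst_apply hs, withDensity_apply _ hms]
  have hle : ∀ n, ∫⁻ p in Prod.fst ⁻¹' s, ‖G n p - g p‖ₑ ∂(mX.prod mY) ≤
      ∫⁻ p, ‖G n p - g p‖ₑ ∂(mX.prod mY) := fun n => setLIntegral_le_lintegral _ _
  have hdm : ∀ n, Measurable fun p => ‖G n p - g p‖ₑ := fun n =>
    ((hG n).measurable.sub hgm).enorm
  refine le_antisymm ?_ ?_
  · refine ge_of_tendsto' (x := atTop)
      (f := fun n => μ s + ∫⁻ p, ‖G n p - g p‖ₑ ∂(mX.prod mY)) ?_ fun n => ?_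
    · simpa using tendsto_const_nhds.add hlim
    · refine le_trans ?_ (add_le_add_right (hle n) (μ s))
      rw [← e n, ← lintegral_add_left (hG n).measurable.ennreal_ofReal]
      refine lintegral_mono fun p => ?_
      rw [Real.enorm_eq_ofReal_abs, ← ENNReal.ofReal_add ((hG n).nonneg p) (abs_nonneg _)]
      refine ENNReal.ofReal_le_ofReal ?_
      linarith [neg_abs_le (G n p - g p)]
  · refine ge_of_tendsto' (x := atTop)
      (f := fun n => (∫⁻ p in Prod.fst ⁻¹' s, ENNReal.ofReal (g p) ∂(mX.prod mY)) +
        ∫⁻ p, ‖G n p - g p‖ₑ ∂(mX.prod mY)) ?_ fun n => ?_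
    · simpa using tendsto_const_nhds.add hlim
    · refine le_trans ?_ (add_le_add_right (hle n) _)
      rw [← e n, ← lintegral_add_left hgm.ennreal_ofReal]
      refine lintegral_mono fun p => ?_
      rw [Real.enorm_eq_ofReal_abs, ← ENNReal.ofReal_add (hg0 p) (abs_nonneg _)]
      refine ENNReal.ofReal_le_ofReal ?_
      linarith [le_abs_self (G n p - g p)]

end IsPlanDensity

variable [SFinite mX]

lemma ENNReal.liminf_add_liminf_le (a b : ℕ → ℝ≥0∞) :
    liminf a atTop + liminf b atTop ≤ liminf (fun n => a n + b n) atTop := by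
  simp only [liminf_eq_iSup_iInf_of_nat]
  rw [ENNReal.iSup_add_iSup_of_monotone]
  · refine iSup_mono fun n => le_iInf₂ fun i hi => add_le_add ?_ ?_
    · exact iInf₂_le i hi
    · exact iInf₂_le i hi
  · exact fun n m hnm => le_iInf₂ fun i hi => iInf₂_le i (hnm.trans hi)
  · exact fun n m hnm => le_iInf₂ fun i hi => iInf₂_le i (hnm.trans hi)

variable {E₁ : X × Y → ℝ → ℝ≥0∞} {E₂ : Y → ℝ → ℝ≥0∞} {κ : ℝ} {μ : Measure X}

lemma jointFunctional_le_of_tendsto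
    (hE₁m : Measurable fun q : (X × Y) × ℝ => E₁ q.1 q.2)
    (hE₂m : Measurable fun q : Y × ℝ => E₂ q.1 q.2)
    (hE₁c : ∀ p, Continuous (E₁ p)) (hE₂c : ∀ y, Continuous (E₂ y))
    {G : ℕ → X × Y → ℝ} {g : X × Y → ℝ} (hG : ∀ n, Measurable (G n))
    (hg : ∀ᵐ p ∂(mX.prod mY), Tendsto (fun n => G n p) atTop (𝓝 (g p)))
    (hm : ∀ᵐ y ∂mY, Tendsto (fun n => marginalSnd mX (G n) y) atTop (𝓝 (marginalSnd mX g y)))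
    {b : ℕ → ℝ≥0∞} {m : ℝ≥0∞} (hb : Tendsto b atTop (𝓝 m))
    (hle : ∀ n, jointFunctional mX mY E₁ E₂ (G n) ≤ b n) :
    jointFunctional mX mY E₁ E₂ g ≤ m := by
  have h₁ : ∫⁻ p, E₁ p (g p) ∂(mX.prod mY) ≤
      liminf (fun n => ∫⁻ p, E₁ p (G n p) ∂(mX.prod mY)) atTop := by
    refine le_trans (lintegral_mono_ae ?_) (lintegral_liminf_le fun n =>
      hE₁m.comp (measurable_id.prodMk (hG n)))
    filter_upwards [hg] with p hp
    exact (((hE₁c p).tendsto _).comp hp).liminf_eq.ge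
  have h₂ : ∫⁻ y, E₂ y (marginalSnd mX g y) ∂mY ≤
      liminf (fun n => ∫⁻ y, E₂ y (marginalSnd mX (G n) y) ∂mY) atTop := by
    refine le_trans (lintegral_mono_ae ?_) (lintegral_liminf_le fun n =>
      hE₂m.comp (measurable_id.prodMk (measurable_marginalSnd (hG n))))
    filter_upwards [hm] with y hy
    exact (((hE₂c y).tendsto _).comp hy).liminf_eq.ge
  calc jointFunctional mX mY E₁ E₂ g ≤ _ := add_le_add h₁ h₂
    _ ≤ _ := ENNReal.liminf_add_liminf_le _ _
    _ ≤ liminf b atTop := liminf_le_liminf (Eventually.of_forall hle)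
    _ = m := hb.liminf_eq

variable [SFinite mY]

lemma lintegral_enorm_marginalSnd_sub_le {g₁ g₂ : X × Y → ℝ}
    (h₁ : Integrable g₁ (mX.prod mY)) (h₂ : Integrable g₂ (mX.prod mY)) :
    ∫⁻ y, ‖marginalSnd mX g₁ y - marginalSnd mX g₂ y‖ₑ ∂mY ≤
      ∫⁻ p, ‖g₁ p - g₂ p‖ₑ ∂(mX.prod mY) := by
  have hm : AEMeasurable (fun p => ‖g₁ p - g₂ p‖ₑ) (mX.prod mY) :=
    (h₁.sub h₂).aestronglyMeasurable.enorm
  rw [lintegral_prod_symm _ hm]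
  refine lintegral_mono_ae ?_
  filter_upwards [h₁.prod_left_ae, h₂.prod_left_ae] with y hy₁ hy₂
  rw [marginalSnd, marginalSnd, ← integral_sub hy₁ hy₂]
  exact enorm_integral_le_lintegral_enorm _

lemma marginalSnd_midpoint_ae {g₁ g₂ : X × Y → ℝ}
    (h₁ : Integrable g₁ (mX.prod mY)) (h₂ : Integrable g₂ (mX.prod mY)) :
    ∀ᵐ y ∂mY, marginalSnd mX (fun p => (g₁ p + g₂ p) / 2) y =
      (marginalSnd mX g₁ y + marginalSnd mX g₂ y) / 2 := by
  filter_upwards [h₁.prod_left_ae, h₂.prod_left_ae] with y hy₁ hy₂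
  rw [marginalSnd, marginalSnd, marginalSnd, ← integral_add hy₁ hy₂, integral_div]

lemma two_mul_jointFunctional_midpoint_add_le [IsProbabilityMeasure μ]
    (hE₁m : Measurable fun q : (X × Y) × ℝ => E₁ q.1 q.2)
    (hE₂m : Measurable fun q : Y × ℝ => E₂ q.1 q.2) (hκ : 0 ≤ κ)
    (hE₁v : ∀ p s t l, 0 ≤ s → 0 ≤ t → 0 ≤ l →
      2 * E₁ p ((s + t) / 2) + ENNReal.ofReal (κ * l * |s - t|) ≤
        E₁ p s + E₁ p t + ENNReal.ofReal (κ * l ^ 2 * (s + t)))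
    (hE₂v : ∀ y s t, 0 ≤ s → 0 ≤ t → 2 * E₂ y ((s + t) / 2) ≤ E₂ y s + E₂ y t)
    {g₁ g₂ : X × Y → ℝ} (h₁ : IsPlanDensity mX mY μ g₁) (h₂ : IsPlanDensity mX mY μ g₂)
    {l : ℝ} (hl : 0 ≤ l) :
    2 * jointFunctional mX mY E₁ E₂ (fun p => (g₁ p + g₂ p) / 2) +
        ENNReal.ofReal (κ * l) * ∫⁻ p, ‖g₁ p - g₂ p‖ₑ ∂(mX.prod mY) ≤
      jointFunctional mX mY E₁ E₂ g₁ + jointFunctional mX mY E₁ E₂ g₂ +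
        ENNReal.ofReal (2 * κ * l ^ 2) := by
  have m₁ : Measurable fun p => E₁ p (g₁ p) := hE₁m.comp (measurable_id.prodMk h₁.measurable)
  have m₂ : Measurable fun p => E₁ p (g₂ p) := hE₁m.comp (measurable_id.prodMk h₂.measurable)
  have mm : Measurable fun p => E₁ p ((g₁ p + g₂ p) / 2) :=
    hE₁m.comp (measurable_id.prodMk (h₁.midpoint h₂).measurable)
  have n₁ : Measurable fun y => E₂ y (marginalSnd mX g₁ y) :=
    hE₂m.comp (measurable_id.prodMk (measurable_marginalSnd h₁.measurable))
  have hfirst : 2 * ∫⁻ p, E₁ p ((g₁ p + g₂ p) / 2) ∂(mX.prod mY) +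
      ENNReal.ofReal (κ * l) * ∫⁻ p, ‖g₁ p - g₂ p‖ₑ ∂(mX.prod mY) ≤
      ∫⁻ p, E₁ p (g₁ p) ∂(mX.prod mY) + ∫⁻ p, E₁ p (g₂ p) ∂(mX.prod mY) +
        ENNReal.ofReal (2 * κ * l ^ 2) := by
    have hc : ENNReal.ofReal (2 * κ * l ^ 2) = ∫⁻ p, ENNReal.ofReal (κ * l ^ 2) *
        (ENNReal.ofReal (g₁ p) + ENNReal.ofReal (g₂ p)) ∂(mX.prod mY) := by
      have hsum : Measurable fun p => ENNReal.ofReal (g₁ p) + ENNReal.ofReal (g₂ p) :=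
        h₁.measurable.ennreal_ofReal.add h₂.measurable.ennreal_ofReal
      rw [lintegral_const_mul _ hsum, lintegral_add_left h₁.measurable.ennreal_ofReal,
        h₁.lintegral_ofReal,
        h₂.lintegral_ofReal, measure_univ, one_add_one_eq_two,
        show 2 * κ * l ^ 2 = κ * l ^ 2 * 2 by ring, ENNReal.ofReal_mul (by positivity)]
      simp
    have hdiff : Measurable fun p => ‖g₁ p - g₂ p‖ₑ := (h₁.measurable.sub h₂.measurable).enorm
    have m₁₂ : Measurable fun p => E₁ p (g₁ p) + E₁ p (g₂ p) := m₁.add m₂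
    rw [hc, ← lintegral_const_mul _ mm, ← lintegral_const_mul _ hdiff,
      ← lintegral_add_left (mm.const_mul 2), ← lintegral_add_left m₁, ← lintegral_add_left m₁₂]
    refine lintegral_mono fun p => ?_
    have := hE₁v p (g₁ p) (g₂ p) l (h₁.nonneg p) (h₂.nonneg p) hl
    rw [ENNReal.ofReal_mul (by positivity : 0 ≤ κ * l),
      ENNReal.ofReal_mul (by positivity : 0 ≤ κ * l ^ 2),
      ENNReal.ofReal_add (h₁.nonneg p) (h₂.nonneg p), ← Real.enorm_eq_ofReal_abs] at this
    exact this
  have hsecond : 2 * ∫⁻ y, E₂ y (marginalSnd mX (fun p => (g₁ p + g₂ p) / 2) y) ∂mY ≤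
      ∫⁻ y, E₂ y (marginalSnd mX g₁ y) ∂mY + ∫⁻ y, E₂ y (marginalSnd mX g₂ y) ∂mY := by
    have nm : Measurable fun y => E₂ y (marginalSnd mX (fun p => (g₁ p + g₂ p) / 2) y) :=
      hE₂m.comp (measurable_id.prodMk (measurable_marginalSnd (h₁.midpoint h₂).measurable))
    rw [← lintegral_const_mul _ nm, ← lintegral_add_left n₁]
    refine lintegral_mono_ae ?_
    filter_upwards [marginalSnd_midpoint_ae h₁.integrable h₂.integrable] with y hy
    rw [hy]
    exact hE₂v y _ _ (integral_nonneg fun _ => h₁.nonneg _) (integral_nonneg fun _ => h₂.nonneg _)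
  calc _ = (2 * ∫⁻ p, E₁ p ((g₁ p + g₂ p) / 2) ∂(mX.prod mY) +
        ENNReal.ofReal (κ * l) * ∫⁻ p, ‖g₁ p - g₂ p‖ₑ ∂(mX.prod mY)) +
        2 * ∫⁻ y, E₂ y (marginalSnd mX (fun p => (g₁ p + g₂ p) / 2) y) ∂mY := by
        rw [jointFunctional]; ring
    _ ≤ _ := add_le_add hfirst hsecond
    _ = _ := by rw [jointFunctional, jointFunctional]; ring

/-- Almost minimisers of a strongly convex joint functional are close in `L¹`. -/
lemma lintegral_enorm_sub_le_of_almost_minimizer [IsProbabilityMeasure μ]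
    (hE₁m : Measurable fun q : (X × Y) × ℝ => E₁ q.1 q.2)
    (hE₂m : Measurable fun q : Y × ℝ => E₂ q.1 q.2) (hκ : 0 < κ)
    (hE₁v : ∀ p s t l, 0 ≤ s → 0 ≤ t → 0 ≤ l →
      2 * E₁ p ((s + t) / 2) + ENNReal.ofReal (κ * l * |s - t|) ≤
        E₁ p s + E₁ p t + ENNReal.ofReal (κ * l ^ 2 * (s + t)))
    (hE₂v : ∀ y s t, 0 ≤ s → 0 ≤ t → 2 * E₂ y ((s + t) / 2) ≤ E₂ y s + E₂ y t)
    {m : ℝ≥0∞} (hm : m ≠ ⊤)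
    (hmin : ∀ g, IsPlanDensity mX mY μ g → m ≤ jointFunctional mX mY E₁ E₂ g)
    {g₁ g₂ : X × Y → ℝ} (h₁ : IsPlanDensity mX mY μ g₁) (h₂ : IsPlanDensity mX mY μ g₂)
    {l : ℝ} (hl : 0 < l)
    (hle₁ : jointFunctional mX mY E₁ E₂ g₁ ≤ m + ENNReal.ofReal (κ * l ^ 2))
    (hle₂ : jointFunctional mX mY E₁ E₂ g₂ ≤ m + ENNReal.ofReal (κ * l ^ 2)) :
    ∫⁻ p, ‖g₁ p - g₂ p‖ₑ ∂(mX.prod mY) ≤ ENNReal.ofReal (4 * l) := by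
  have h := two_mul_jointFunctional_midpoint_add_le hE₁m hE₂m hκ.le hE₁v hE₂v h₁ h₂ hl.le
  have hsum : 2 * m + ENNReal.ofReal (κ * l) * ∫⁻ p, ‖g₁ p - g₂ p‖ₑ ∂(mX.prod mY) ≤
      2 * m + ENNReal.ofReal (κ * l) * ENNReal.ofReal (4 * l) := by
    calc _ ≤ _ := add_le_add_left (mul_le_mul_right (hmin _ (h₁.midpoint h₂)) 2) _
      _ ≤ _ := h
      _ ≤ _ := add_le_add_left (add_le_add hle₁ hle₂) _
      _ = _ := by
        rw [← ENNReal.ofReal_mul (by positivity),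
          show κ * l * (4 * l) = κ * l ^ 2 + κ * l ^ 2 + 2 * κ * l ^ 2 by ring,
          ENNReal.ofReal_add (by positivity) (by positivity),
          ENNReal.ofReal_add (by positivity) (by positivity)]
        ring
  have hm2 : 2 * m ≠ ⊤ := ENNReal.mul_ne_top (by norm_num) hm
  rw [ENNReal.add_le_add_iff_left hm2, ENNReal.mul_le_mul_iff_right
    (by simpa using mul_pos hκ hl) ENNReal.ofReal_ne_top] at hsum
  exact hsum

/-- A strongly convex, lower semicontinuous joint functional attains its infimum over the
densities with prescribed first marginal. -/
theorem exists_jointFunctional_minimizer [IsProbabilityMeasure μ]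
    (hE₁m : Measurable fun q : (X × Y) × ℝ => E₁ q.1 q.2)
    (hE₂m : Measurable fun q : Y × ℝ => E₂ q.1 q.2) (hκ : 0 < κ)
    (hE₁c : ∀ p, Continuous (E₁ p)) (hE₂c : ∀ y, Continuous (E₂ y))
    (hE₁v : ∀ p s t l, 0 ≤ s → 0 ≤ t → 0 ≤ l →
      2 * E₁ p ((s + t) / 2) + ENNReal.ofReal (κ * l * |s - t|) ≤
        E₁ p s + E₁ p t + ENNReal.ofReal (κ * l ^ 2 * (s + t)))
    (hE₂v : ∀ y s t, 0 ≤ s → 0 ≤ t → 2 * E₂ y ((s + t) / 2) ≤ E₂ y s + E₂ y t)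
    (hfin : ∃ g, IsPlanDensity mX mY μ g ∧ jointFunctional mX mY E₁ E₂ g ≠ ⊤) :
    ∃ g, IsPlanDensity mX mY μ g ∧ jointFunctional mX mY E₁ E₂ g ≠ ⊤ ∧
      ∀ g', IsPlanDensity mX mY μ g' →
        jointFunctional mX mY E₁ E₂ g ≤ jointFunctional mX mY E₁ E₂ g' := by
  set J := jointFunctional mX mY E₁ E₂ with hJ
  set m : ℝ≥0∞ := ⨅ g : {g // IsPlanDensity mX mY μ g}, J g with hmdef
  have hmin : ∀ g, IsPlanDensity mX mY μ g → m ≤ J g := fun g hg =>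
    iInf_le (fun g : {g // IsPlanDensity mX mY μ g} => J g) ⟨g, hg⟩
  have hm : m ≠ ⊤ := by
    obtain ⟨g, hg, hgt⟩ := hfin
    exact ne_top_of_le_ne_top hgt (hmin g hg)
  have hl : ∀ n : ℕ, (0 : ℝ) < (1 / 2) ^ n := fun n => by positivity
  have hex : ∀ n : ℕ, ∃ g, IsPlanDensity mX mY μ g ∧
      J g ≤ m + ENNReal.ofReal (κ * ((1 / 2) ^ n) ^ 2) := fun n => by
    have hlt : m < m + ENNReal.ofReal (κ * ((1 / 2) ^ n) ^ 2) :=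
      ENNReal.lt_add_right hm (by simpa using by positivity)
    rw [hmdef, iInf_lt_iff] at hlt
    obtain ⟨⟨g, hg⟩, hlt⟩ := hlt
    exact ⟨g, hg, hlt.le⟩
  choose G hG hGle using hex
  have hcau : ∀ N n k : ℕ, N ≤ n → N ≤ k →
      eLpNorm (G n - G k) 1 (mX.prod mY) < ENNReal.ofReal (5 * (1 / 2) ^ N) := by
    intro N n k hn hk
    have hmono : ∀ j : ℕ, N ≤ j → J (G j) ≤ m + ENNReal.ofReal (κ * ((1 / 2) ^ N) ^ 2) :=
      fun j hj => (hGle j).trans <| by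
        have : ((1 : ℝ) / 2) ^ j ≤ (1 / 2) ^ N :=
          pow_le_pow_of_le_one (by norm_num) (by norm_num) hj
        gcongr
    rw [eLpNorm_one_eq_lintegral_enorm]
    refine lt_of_le_of_lt (lintegral_enorm_sub_le_of_almost_minimizer hE₁m hE₂m hκ hE₁v hE₂v hm
      hmin (hG n) (hG k) (hl N) (hmono n hn) (hmono k hk)) ?_
    exact (ENNReal.ofReal_lt_ofReal_iff (by positivity)).2 (by nlinarith [hl N])
  have hB : ∑' N : ℕ, ENNReal.ofReal (5 * (1 / 2) ^ N) ≠ ⊤ :=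
    (summable_geometric_two.mul_left 5).tsum_ofReal_ne_top
  have hae : ∀ n, AEStronglyMeasurable (G n) (mX.prod mY) := fun n =>
    (hG n).measurable.aestronglyMeasurable
  obtain ⟨g₀, hg₀m, hg₀⟩ := measurable_limit_of_tendsto_metrizable_ae
    (fun n => (hG n).measurable.aemeasurable)
    (Lp.ae_tendsto_of_cauchy_eLpNorm hae le_rfl hB hcau)
  set g : X × Y → ℝ := fun p => max (g₀ p) 0 with hgdef
  have hgm : Measurable g := hg₀m.max measurable_const
  have hg0 : ∀ p, 0 ≤ g p := fun p => le_max_right _ _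
  have hglim : ∀ᵐ p ∂(mX.prod mY), Tendsto (fun n => G n p) atTop (𝓝 (g p)) := by
    filter_upwards [hg₀] with p hp
    have : g p = g₀ p := max_eq_left (ge_of_tendsto' hp fun n => (hG n).nonneg p)
    rwa [this]
  have hL1 : Tendsto (fun n => ∫⁻ p, ‖G n p - g p‖ₑ ∂(mX.prod mY)) atTop (𝓝 0) := by
    have := Lp.cauchy_tendsto_of_tendsto hae g hB hcau hglim
    simpa only [eLpNorm_one_eq_lintegral_enorm, Pi.sub_apply] using this
  have hgA : IsPlanDensity mX mY μ g := IsPlanDensity.of_tendsto hG hgm hg0 hL1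
  have hmL1 : Tendsto (fun n => eLpNorm (marginalSnd mX (G n) - marginalSnd mX g) 1 mY)
      atTop (𝓝 0) := by
    refine tendsto_of_tendsto_of_tendsto_of_le_of_le tendsto_const_nhds hL1
      (fun _ => zero_le) fun n => ?_
    simp only [eLpNorm_one_eq_lintegral_enorm]
    exact lintegral_enorm_marginalSnd_sub_le (hG n).integrable hgA.integrable
  obtain ⟨ns, hns, hnslim⟩ := (tendstoInMeasure_of_tendsto_eLpNorm one_ne_zero
    (fun n => (measurable_marginalSnd (hG n).measurable).aestronglyMeasurable)
    (measurable_marginalSnd hgm).aestronglyMeasurable hmL1).exists_seq_tendsto_ae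
  have hb : Tendsto (fun n => m + ENNReal.ofReal (κ * ((1 / 2) ^ n) ^ 2)) atTop (𝓝 m) := by
    have h0 : Tendsto (fun n : ℕ => κ * (((1 : ℝ) / 2) ^ n) ^ 2) atTop (𝓝 0) := by
      simpa using ((tendsto_pow_atTop_nhds_zero_of_lt_one (by norm_num)
        (by norm_num : (1 : ℝ) / 2 < 1)).pow 2).const_mul κ
    simpa using tendsto_const_nhds.add (ENNReal.tendsto_ofReal h0)
  have hJg : J g ≤ m := jointFunctional_le_of_tendsto hE₁m hE₂m hE₁c hE₂c
    (fun n => (hG (ns n)).measurable)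
    (hglim.mono fun p hp => hp.comp hns.tendsto_atTop) hnslim
    (hb.comp hns.tendsto_atTop) fun n => hGle (ns n)
  exact ⟨g, hgA, ne_top_of_le_ne_top hm hJg, fun g' hg' => hJg.trans (hmin g' hg')⟩

end StrongConvexMinimization

section RealInequalities

/-- `s log s` lies above its tangent lines, parametrised by the exponent of the base point. -/
lemma Real.nonneg_mul_log_add {s : ℝ} (hs : 0 ≤ s) (A : ℝ) :
    0 ≤ s * Real.log s + A * s + Real.exp (-A) := by
  rcases hs.eq_or_lt with rfl | hs
  · simpa using (Real.exp_pos _).le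
  · have h := Real.log_le_sub_one_of_pos (div_pos (Real.exp_pos (-A)) hs)
    rw [Real.log_div (Real.exp_pos _).ne' hs.ne', Real.log_exp] at h
    have h' := mul_le_mul_of_nonneg_left h hs.le
    have : s * (Real.exp (-A) / s - 1) = Real.exp (-A) - s := by field_simp
    nlinarith

lemma Real.mul_log_sub_ge_sqrt_sub_sq {s m : ℝ} (hs : 0 ≤ s) (hm : 0 < m) :
    s - m + (√s - √m) ^ 2 ≤ s * Real.log s - s * Real.log m := by
  rcases hs.eq_or_lt with rfl | hs
  · simp [Real.sq_sqrt hm.le]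
  · have hs' := Real.sqrt_pos.2 hs
    have hm' := Real.sqrt_pos.2 hm
    have h := Real.log_le_sub_one_of_pos (div_pos hm' hs')
    rw [Real.log_div hm'.ne' hs'.ne', Real.log_sqrt hm.le, Real.log_sqrt hs.le] at h
    have h' := mul_le_mul_of_nonneg_left h hs.le
    have e : s * (√m / √s - 1) = √s * √m - s := by
      nth_rewrite 1 [← Real.mul_self_sqrt hs.le]
      field_simp
      rw [mul_sub, ← pow_two √s, Real.sq_sqrt hs.le]
    rw [e] at h'
    nlinarith [Real.sq_sqrt hs.le, Real.sq_sqrt hm.le]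

/-- Strong convexity of `s log s`. -/
lemma Real.two_mul_mul_log_midpoint_add_le {s t l : ℝ} (hs : 0 ≤ s) (ht : 0 ≤ t) :
    2 * ((s + t) / 2 * Real.log ((s + t) / 2)) + l * |s - t| ≤
      s * Real.log s + t * Real.log t + l ^ 2 * (s + t) := by
  rcases (add_nonneg hs ht).eq_or_lt with h | h
  · obtain ⟨rfl, rfl⟩ := (add_eq_zero_iff_of_nonneg hs ht).1 h.symm
    simp
  · have hm : 0 < (s + t) / 2 := by linarith
    have h₁ := Real.mul_log_sub_ge_sqrt_sub_sq hs hm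
    have h₂ := Real.mul_log_sub_ge_sqrt_sub_sq ht hm
    have hst : |s - t| = |√s - √t| * (√s + √t) := by
      rw [← abs_of_nonneg (add_nonneg (Real.sqrt_nonneg s) (Real.sqrt_nonneg t)), ← abs_mul]
      congr 1
      nlinarith [Real.sq_sqrt hs, Real.sq_sqrt ht]
    have h₃ : 2 * (l * |s - t|) ≤ (√s - √t) ^ 2 + 2 * (l ^ 2 * (s + t)) := by
      rw [hst]
      nlinarith [sq_nonneg (|√s - √t| - l * (√s + √t)), sq_abs (√s - √t), Real.sq_sqrt hs,
        Real.sq_sqrt ht, mul_nonneg (sq_nonneg l) (sq_nonneg (√s - √t))]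
    nlinarith [sq_nonneg (√s + √t - 2 * √((s + t) / 2))]

/-- A weighted Young inequality for concave powers. -/
lemma Real.mul_rpow_le_weighted {C a w s α : ℝ} (hC : 0 < C) (ha : 0 < a) (hw : 0 < w)
    (hs : 0 ≤ s) (hα₀ : 0 < α) (hα₁ : α < 1) :
    C * s ^ α ≤ a * w * s + C * (C / a) ^ (α / (1 - α)) * w ^ (-(α / (1 - α))) := by
  have hnn : 0 ≤ C * (C / a) ^ (α / (1 - α)) * w ^ (-(α / (1 - α))) := by positivity
  by_cases hle : C * s ^ α ≤ a * w * s
  · linarith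
  · push Not at hle
    have hs0 : 0 < s := by
      rcases hs.eq_or_lt with rfl | h
      · simp [Real.zero_rpow hα₀.ne'] at hle
      · exact h
    have hα : 0 < 1 - α := by linarith
    have hlt : s ^ (1 - α) ≤ C / (a * w) := by
      rw [le_div_iff₀ (by positivity), Real.rpow_sub hs0, Real.rpow_one, div_mul_eq_mul_div,
        div_le_iff₀ (Real.rpow_pos_of_pos hs0 _)]
      nlinarith
    have hpow := Real.rpow_le_rpow (by positivity) hlt (by positivity : 0 ≤ α / (1 - α))
    rw [← Real.rpow_mul hs, mul_div_cancel₀ _ hα.ne', ← div_div,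
      Real.div_rpow (by positivity) hw.le] at hpow
    have := mul_le_mul_of_nonneg_left hpow hC.le
    rw [Real.rpow_neg hw.le]
    have hz : 0 ≤ a * w * s := by positivity
    calc C * s ^ α ≤ _ := this
      _ = C * (C / a) ^ (α / (1 - α)) * (w ^ (α / (1 - α)))⁻¹ := by ring
      _ ≤ _ := by linarith

/-- A convex function on `[0, ∞)` vanishing at `0` and bounded below by `-C s ^ α` is
continuous up to the boundary. -/
lemma continuous_comp_max_zero {u : ℝ → ℝ} {C α : ℝ} (hα : 0 < α)
    (huconv : ConvexOn ℝ (Set.Ici 0) u) (hu0 : u 0 = 0)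
    (hulb : ∀ s : ℝ, 0 ≤ s → -C * s ^ α ≤ u s) : Continuous fun s => u (max s 0) := by
  have hon : ContinuousOn u (Set.Ici 0) := by
    intro s hs
    rcases (Set.mem_Ici.1 hs).eq_or_lt with rfl | hs
    · rw [ContinuousWithinAt, hu0]
      have hlow : Tendsto (fun s : ℝ => -C * s ^ α) (𝓝[Set.Ici 0] 0) (𝓝 0) := by
        have : Tendsto (fun s : ℝ => -C * s ^ α) (𝓝 0) (𝓝 (-C * 0 ^ α)) :=
          ((Real.continuous_rpow_const hα.le).const_mul (-C)).tendsto 0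
        rw [Real.zero_rpow hα.ne', mul_zero] at this
        exact this.mono_left nhdsWithin_le_nhds
      have hupp : Tendsto (fun s : ℝ => s * u 1) (𝓝[Set.Ici 0] 0) (𝓝 0) := by
        have : Tendsto (fun s : ℝ => s * u 1) (𝓝 0) (𝓝 (0 * u 1)) :=
          (continuous_id.mul continuous_const).tendsto 0
        rw [zero_mul] at this
        exact this.mono_left nhdsWithin_le_nhds
      refine tendsto_of_tendsto_of_tendsto_of_le_of_le' hlow hupp ?_ ?_
      · filter_upwards [self_mem_nhdsWithin] with s hs using hulb s hs
      · have h1 : ∀ᶠ s : ℝ in 𝓝[Set.Ici 0] 0, s < 1 :=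
          nhdsWithin_le_nhds (Iio_mem_nhds one_pos)
        filter_upwards [self_mem_nhdsWithin, h1] with s hs hs1
        have := huconv.2 (Set.mem_Ici.2 le_rfl : (0 : ℝ) ∈ Set.Ici 0)
          (Set.mem_Ici.2 zero_le_one) (sub_nonneg.2 hs1.le) hs (by ring)
        simpa [hu0] using this
    · have hint : ContinuousOn u (Set.Ioi 0) :=
        (huconv.subset Set.Ioi_subset_Ici_self (convex_Ioi 0)).continuousOn isOpen_Ioi
      exact (hint.continuousAt (Ioi_mem_nhds hs)).continuousWithinAt
  rw [← continuousOn_univ]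
  exact hon.comp (continuous_id.max continuous_const).continuousOn fun s _ => le_max_right s 0

end RealInequalities

section ExtendedReal

lemma EReal.coe_le_mul_iInf {ι : Type*} {S : Set ι} {x : ι → EReal} {k z : ℝ} (hk : 0 < k)
    (h : ∀ i ∈ S, (z : EReal) ≤ k * x i) : (z : EReal) ≤ k * ⨅ i ∈ S, x i := by
  have hle : ((z / k : ℝ) : EReal) ≤ ⨅ i ∈ S, x i := by
    refine le_iInf₂ fun i hi => ?_
    have hi := h i hi
    generalize x i = y at hi
    induction y with
    | bot => simp [EReal.coe_mul_bot_of_pos hk] at hi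
    | top => exact le_top
    | coe r =>
      rw [← EReal.coe_mul, EReal.coe_le_coe_iff] at hi
      rw [EReal.coe_le_coe_iff, div_le_iff₀ hk]
      linarith
  calc (z : EReal) = (k : EReal) * ((z / k : ℝ) : EReal) := by
        rw [← EReal.coe_mul, mul_div_cancel₀ _ hk.ne']
    _ ≤ _ := by
        have : (0 : EReal) ≤ k := by exact_mod_cast hk.le
        gcongr

lemma EReal.coe_le_mul_iInf_add {ι : Type*} {S : Set ι} {x : ι → EReal} {k B q : ℝ} (hk : 0 < k)
    (hq : ∀ i ∈ S, (q : EReal) ≤ k * x i) {F : EReal} (hF : F ≠ ⊥)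
    (h : ∀ i ∈ S, (B : EReal) ≤ k * x i + F) : (B : EReal) ≤ k * (⨅ i ∈ S, x i) + F := by
  induction F with
  | bot => exact absurd rfl hF
  | top =>
    rw [EReal.add_top_of_ne_bot]
    · exact le_top
    · exact ne_bot_of_le_ne_bot (EReal.coe_ne_bot q) (EReal.coe_le_mul_iInf hk hq)
  | coe r =>
    have : ((B - r : ℝ) : EReal) ≤ k * ⨅ i ∈ S, x i := by
      refine EReal.coe_le_mul_iInf hk fun i hi => ?_
      have hi := h i hi
      rw [EReal.coe_sub]
      exact EReal.sub_le_of_le_add hi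
    calc (B : EReal) = ((B - r : ℝ) : EReal) + r := by rw [← EReal.coe_add]; simp
      _ ≤ _ := by gcongr

/-- The extended integral of a nonnegative function of the form `L + κ φ`, with `L` integrable. -/
lemma coe_lintegral_ofReal_eq {Ω : Type*} [MeasurableSpace Ω] {ρ : Measure Ω} {F L φ : Ω → ℝ}
    {κ : ℝ} (hκ : 0 < κ) (hF : ∀ᵐ x ∂ρ, F x = L x + κ * φ x) (hF0 : ∀ᵐ x ∂ρ, 0 ≤ F x)
    (hL : Integrable L ρ) (hφ : AEStronglyMeasurable φ ρ) :
    ((∫⁻ x, ENNReal.ofReal (F x) ∂ρ : ℝ≥0∞) : EReal) = ((∫ x, L x ∂ρ : ℝ) : EReal) +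
      κ * (if Integrable φ ρ then ((∫ x, φ x ∂ρ : ℝ) : EReal) else ⊤) := by
  split_ifs with hi
  · have hFi : Integrable F ρ := (hL.add (hi.const_mul κ)).congr (hF.mono fun x hx => hx.symm)
    rw [← ofReal_integral_eq_lintegral_ofReal hFi hF0, EReal.coe_ennreal_ofReal,
      max_eq_left (integral_nonneg_of_ae hF0), integral_congr_ae hF,
      integral_add hL (hi.const_mul κ), integral_const_mul, EReal.coe_add, EReal.coe_mul]
  · have htop : ∫⁻ x, ENNReal.ofReal (F x) ∂ρ = ⊤ := by
      by_contra hne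
      have hFm : AEStronglyMeasurable F ρ :=
        (hL.aestronglyMeasurable.add (hφ.const_mul κ)).congr (hF.mono fun x hx => hx.symm)
      have hFi : Integrable F ρ :=
        ⟨hFm, (hasFiniteIntegral_iff_ofReal hF0).2 (lt_top_iff_ne_top.2 hne)⟩
      refine hi (((hFi.sub hL).const_mul κ⁻¹).congr ?_)
      filter_upwards [hF] with x hx
      simp only [Pi.sub_apply, hx]
      field_simp
      ring
    rw [htop, EReal.coe_mul_top_of_pos hκ, EReal.coe_ennreal_top, EReal.coe_add_top]

end ExtendedReal

section DensityOfMarginal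

variable {X Y : Type*} [MeasureSpace X] [MeasureSpace Y]

lemma measurable_dens (ρ : Measure X) : Measurable (dens ρ) :=
  (Measure.measurable_rnDeriv ρ volume).ennreal_toReal

lemma dens_nonneg (ρ : Measure X) (x : X) : 0 ≤ dens ρ x := ENNReal.toReal_nonneg

lemma withDensity_ofReal_dens [SigmaFinite (volume : Measure X)] {ρ : Measure X}
    [IsFiniteMeasure ρ] (hρ : ρ ≪ volume) :
    (volume : Measure X).withDensity (fun x => ENNReal.ofReal (dens ρ x)) = ρ := by
  conv_rhs => rw [← Measure.withDensity_rnDeriv_eq ρ volume hρ]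
  refine withDensity_congr_ae ?_
  filter_upwards [Measure.rnDeriv_lt_top ρ volume] with x hx
  exact ENNReal.ofReal_toReal hx.ne

lemma dens_withDensity_ofReal [SigmaFinite (volume : Measure X)] {g : X → ℝ} (hg : Measurable g)
    (hg0 : ∀ x, 0 ≤ g x) :
    dens ((volume : Measure X).withDensity fun x => ENNReal.ofReal (g x)) =ᵐ[volume] g := by
  filter_upwards [Measure.rnDeriv_withDensity volume hg.ennreal_ofReal] with x hx
  rw [dens, hx, ENNReal.toReal_ofReal (hg0 x)]

lemma absolutelyContinuous_snd {γ : Measure (X × Y)} (hγ : γ ≪ volume) :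
    γ.snd ≪ (volume : Measure Y) := by
  refine (hγ.map measurable_snd).trans ?_
  rw [Measure.volume_eq_prod]
  exact Measure.quasiMeasurePreserving_snd.absolutelyContinuous

variable [SigmaFinite (volume : Measure X)] [SigmaFinite (volume : Measure Y)]

lemma isPlanDensity_dens {γ : Measure (X × Y)} [IsFiniteMeasure γ] (hγ : γ ≪ volume) :
    IsPlanDensity (volume : Measure X) (volume : Measure Y) γ.fst (dens γ) :=
  ⟨measurable_dens γ, dens_nonneg γ,
    congrArg Measure.fst (withDensity_ofReal_dens (X := X × Y) hγ)⟩

lemma snd_withDensity {g : X × Y → ℝ≥0∞} (hg : Measurable g) :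
    ((volume : Measure (X × Y)).withDensity g).snd =
      (volume : Measure Y).withDensity fun y => ∫⁻ x, g (x, y) := by
  ext s hs
  rw [Measure.snd_apply hs, withDensity_apply _ (measurable_snd hs), withDensity_apply _ hs,
    ← Set.univ_prod, Measure.volume_eq_prod, ← Measure.prod_restrict, Measure.restrict_univ,
    lintegral_prod_symm _ hg.aemeasurable]

lemma dens_snd_ae {γ : Measure (X × Y)} [IsFiniteMeasure γ] (hγ : γ ≪ volume) :
    dens γ.snd =ᵐ[volume] marginalSnd volume (dens γ) := by
  have hm : Measurable fun p => ENNReal.ofReal (dens γ p) := (measurable_dens γ).ennreal_ofReal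
  have h : γ.snd = (volume : Measure Y).withDensity
      fun y => ∫⁻ x, ENNReal.ofReal (dens γ (x, y)) := by
    rw [← snd_withDensity hm, withDensity_ofReal_dens hγ]
  have hmY : Measurable fun y => ∫⁻ x, ENNReal.ofReal (dens γ (x, y)) := hm.lintegral_prod_left'
  have hrn := Measure.rnDeriv_withDensity (volume : Measure Y) hmY
  filter_upwards [hrn] with y hy
  rw [dens, h, hy, marginalSnd, integral_eq_lintegral_of_nonneg_ae
    (Eventually.of_forall fun x => dens_nonneg γ _)
    ((measurable_dens γ).comp measurable_prodMk_right).aestronglyMeasurable]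

end DensityOfMarginal

section RegularisedStep

variable {d : ℕ}

/-- The integrand controlling the transport, entropy and potential terms. -/
def planIntegrand (f : Euc d → ℝ) (c : Euc d × Euc d → ℝ) (k κ a b : ℝ) (p : Euc d × Euc d)
    (s : ℝ) : ℝ :=
  (k * c p + f p.2 + b * ‖p.1‖ ^ 2 - 2 * a * ‖p.2‖ ^ 2) * s +
    κ * (s * Real.log s + a / κ * (‖p.1‖ ^ 2 + ‖p.2‖ ^ 2) * s +
      Real.exp (-(a / κ * (‖p.1‖ ^ 2 + ‖p.2‖ ^ 2))))

/-- The integrand controlling the internal energy. -/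
def marginalIntegrand (u : ℝ → ℝ) (a D r : ℝ) (y : Euc d) (s : ℝ) : ℝ :=
  u (max s 0) + a * (1 + ‖y‖ ^ 2) * s + D * (1 + ‖y‖ ^ 2) ^ (-r)

/-- Quantitative bounds making the regularised step functional coercive and convex. -/
structure StepBounds (f : Euc d → ℝ) (u : ℝ → ℝ) (c : Euc d × Euc d → ℝ)
    (k κ a b D r : ℝ) : Prop where
  k_pos : 0 < k
  κ_pos : 0 < κ
  a_pos : 0 < a
  f_cont : Continuous f
  f_nonneg : ∀ x, 0 ≤ f x
  f_growth : ∃ F : ℝ, ∀ x, f x ≤ F * (1 + ‖x‖ ^ 2)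
  c_cont : Continuous c
  c_nonneg : ∀ p, 0 ≤ c p
  c_growth : ∃ F : ℝ, ∀ p, c p ≤ F * (‖p.1‖ ^ 2 + ‖p.2‖ ^ 2)
  coercive : ∀ p, 3 * a * ‖p.2‖ ^ 2 ≤ k * c p + b * ‖p.1‖ ^ 2
  u_cont : Continuous fun s => u (max s 0)
  u_convex : ConvexOn ℝ (Set.Ici 0) u
  u_lower : ∀ w s : ℝ, 0 < w → 0 ≤ s → 0 ≤ u s + a * w * s + D * w ^ (-r)
  dim_lt : (d : ℝ) < 2 * r

lemma IsP2.integrable_norm_sq {ρ : Measure (Euc d)} (h : IsP2 ρ) :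
    Integrable (fun x => ‖x‖ ^ 2) ρ := by
  refine ⟨by fun_prop, ?_⟩
  have := h.2
  rw [M2] at this
  rw [hasFiniteIntegral_iff_ofReal (Eventually.of_forall fun x => by positivity)]
  refine lt_of_le_of_lt (lintegral_mono fun x => ?_) this
  rw [ENNReal.ofReal_pow (norm_nonneg x), ofReal_norm]
  rfl

lemma integrable_comp_fst {γ : Measure (Euc d × Euc d)} {g : Euc d → ℝ}
    (h : Integrable g γ.fst) : Integrable (fun p => g p.1) γ :=
  (integrable_map_measure h.aestronglyMeasurable measurable_fst.aemeasurable).1 h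

lemma integrable_comp_snd {γ : Measure (Euc d × Euc d)} {g : Euc d → ℝ}
    (h : Integrable g γ.snd) : Integrable (fun p => g p.2) γ :=
  (integrable_map_measure h.aestronglyMeasurable measurable_snd.aemeasurable).1 h

lemma integral_comp_fst {γ : Measure (Euc d × Euc d)} {g : Euc d → ℝ}
    (h : Integrable g γ.fst) : ∫ p, g p.1 ∂γ = ∫ x, g x ∂γ.fst :=
  (integral_map measurable_fst.aemeasurable h.aestronglyMeasurable).symm

lemma integral_comp_snd {γ : Measure (Euc d × Euc d)} {g : Euc d → ℝ}
    (h : Integrable g γ.snd) : ∫ p, g p.2 ∂γ = ∫ y, g y ∂γ.snd :=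
  (integral_map measurable_snd.aemeasurable h.aestronglyMeasurable).symm

lemma integrable_exp_neg_mul_norm_sq {t : ℝ} (ht : 0 < t) :
    Integrable fun x : Euc d => Real.exp (-(t * ‖x‖ ^ 2)) := by
  have h := (GaussianFourier.integrable_cexp_neg_mul_sq_norm_add (V := Euc d) (b := (t : ℂ))
    (by simpa using ht) 0 0).norm
  refine h.congr (Eventually.of_forall fun x => ?_)
  simp only [Complex.norm_exp]
  congr 1
  simp [← Complex.ofReal_pow]

lemma integrable_exp_neg_mul_norm_sq_add {t : ℝ} (ht : 0 < t) :
    Integrable fun p : Euc d × Euc d => Real.exp (-(t * (‖p.1‖ ^ 2 + ‖p.2‖ ^ 2))) := by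
  refine ((integrable_exp_neg_mul_norm_sq ht).mul_prod
    (integrable_exp_neg_mul_norm_sq ht)).congr (Eventually.of_forall fun p => ?_)
  simp only [← Real.exp_add]
  congr 1
  ring

namespace StepBounds

variable {f : Euc d → ℝ} {u : ℝ → ℝ} {c : Euc d × Euc d → ℝ} {k κ a b D r : ℝ}

lemma mul_norm_sq_le_planIntegrand (H : StepBounds f u c k κ a b D r) (p : Euc d × Euc d) {s : ℝ}
    (hs : 0 ≤ s) : a * ‖p.2‖ ^ 2 * s ≤ planIntegrand f c k κ a b p s := by
  have h₁ := mul_le_mul_of_nonneg_right (H.coercive p) hs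
  have h₂ := mul_nonneg H.κ_pos.le
    (Real.nonneg_mul_log_add hs (a / κ * (‖p.1‖ ^ 2 + ‖p.2‖ ^ 2)))
  have h₃ := mul_nonneg (H.f_nonneg p.2) hs
  rw [planIntegrand]
  linarith

lemma planIntegrand_nonneg (H : StepBounds f u c k κ a b D r) (p : Euc d × Euc d) {s : ℝ}
    (hs : 0 ≤ s) : 0 ≤ planIntegrand f c k κ a b p s :=
  le_trans (by have := H.a_pos; positivity) (H.mul_norm_sq_le_planIntegrand p hs)

lemma marginalIntegrand_nonneg (H : StepBounds f u c k κ a b D r) (y : Euc d) {s : ℝ}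
    (hs : 0 ≤ s) : 0 ≤ marginalIntegrand u a D r y s := by
  rw [marginalIntegrand, max_eq_left hs]
  exact H.u_lower _ _ (by positivity) hs

lemma continuous_planIntegrand (H : StepBounds f u c k κ a b D r) :
    Continuous fun q : (Euc d × Euc d) × ℝ => planIntegrand f c k κ a b q.1 q.2 := by
  have := H.f_cont
  have := H.c_cont
  have := Real.continuous_mul_log
  have hlog : Continuous fun q : (Euc d × Euc d) × ℝ => q.2 * Real.log q.2 :=
    this.comp continuous_snd
  unfold planIntegrand
  fun_prop

lemma continuous_marginalIntegrand (H : StepBounds f u c k κ a b D r) :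
    Continuous fun q : Euc d × ℝ => marginalIntegrand u a D r q.1 q.2 := by
  have hu : Continuous fun q : Euc d × ℝ => u (max q.2 0) := H.u_cont.comp continuous_snd
  have hp : Continuous fun q : Euc d × ℝ => (1 + ‖q.1‖ ^ 2) ^ (-r) :=
    Continuous.rpow_const (by fun_prop) fun q => Or.inl (by positivity)
  unfold marginalIntegrand
  exact (hu.add (by fun_prop)).add (hp.const_mul D)

lemma planIntegrand_midpoint (H : StepBounds f u c k κ a b D r) (p : Euc d × Euc d)
    (s t l : ℝ) (hs : 0 ≤ s) (ht : 0 ≤ t) (hl : 0 ≤ l) :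
    2 * ENNReal.ofReal (planIntegrand f c k κ a b p ((s + t) / 2)) +
        ENNReal.ofReal (κ * l * |s - t|) ≤
      ENNReal.ofReal (planIntegrand f c k κ a b p s) +
        ENNReal.ofReal (planIntegrand f c k κ a b p t) +
        ENNReal.ofReal (κ * l ^ 2 * (s + t)) := by
  have hκ := H.κ_pos
  have hst : 0 ≤ (s + t) / 2 := by positivity
  have n₁ := H.planIntegrand_nonneg p hs
  have n₂ := H.planIntegrand_nonneg p ht
  have n₃ := H.planIntegrand_nonneg p hst
  rw [← ENNReal.ofReal_add n₁ n₂, ← ENNReal.ofReal_add (by positivity) (by positivity),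
    ← ENNReal.ofReal_ofNat 2, ← ENNReal.ofReal_mul (by norm_num),
    ← ENNReal.ofReal_add (by positivity) (by positivity)]
  refine ENNReal.ofReal_le_ofReal ?_
  have h := mul_le_mul_of_nonneg_left (Real.two_mul_mul_log_midpoint_add_le (l := l) hs ht) hκ.le
  simp only [planIntegrand]
  linarith

lemma marginalIntegrand_midpoint (H : StepBounds f u c k κ a b D r) (y : Euc d)
    (s t : ℝ) (hs : 0 ≤ s) (ht : 0 ≤ t) :
    2 * ENNReal.ofReal (marginalIntegrand u a D r y ((s + t) / 2)) ≤
      ENNReal.ofReal (marginalIntegrand u a D r y s) +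
        ENNReal.ofReal (marginalIntegrand u a D r y t) := by
  have hst : 0 ≤ (s + t) / 2 := by positivity
  rw [← ENNReal.ofReal_add (H.marginalIntegrand_nonneg y hs) (H.marginalIntegrand_nonneg y ht),
    ← ENNReal.ofReal_ofNat 2, ← ENNReal.ofReal_mul (by norm_num)]
  refine ENNReal.ofReal_le_ofReal ?_
  have h := H.u_convex.2 (Set.mem_Ici.2 hs) (Set.mem_Ici.2 ht)
    (by norm_num : (0 : ℝ) ≤ 1 / 2) (by norm_num : (0 : ℝ) ≤ 1 / 2) (by norm_num)
  simp only [smul_eq_mul] at h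
  rw [show 1 / 2 * s + 1 / 2 * t = (s + t) / 2 by ring] at h
  simp only [marginalIntegrand, max_eq_left hs, max_eq_left ht, max_eq_left hst]
  linarith

lemma integrable_potential (H : StepBounds f u c k κ a b D r) {ρ : Measure (Euc d)}
    (hρ : IsP2 ρ) : Integrable f ρ := by
  obtain ⟨F, hF⟩ := H.f_growth
  have := hρ.1
  refine (((integrable_const (1 : ℝ)).add hρ.integrable_norm_sq).const_mul F).mono'
    H.f_cont.aestronglyMeasurable (Eventually.of_forall fun x => ?_)
  rw [Real.norm_of_nonneg (H.f_nonneg x)]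
  exact hF x

lemma integrable_cost (H : StepBounds f u c k κ a b D r) {γ : Measure (Euc d × Euc d)}
    (h₁ : IsP2 γ.fst) (h₂ : IsP2 γ.snd) : Integrable c γ := by
  obtain ⟨F, hF⟩ := H.c_growth
  refine (((integrable_comp_fst h₁.integrable_norm_sq).add
    (integrable_comp_snd h₂.integrable_norm_sq)).const_mul F).mono'
    H.c_cont.aestronglyMeasurable (Eventually.of_forall fun p => ?_)
  rw [Real.norm_of_nonneg (H.c_nonneg p)]
  exact hF p

/-- The constant relating the plan functional to the transport and potential terms. -/
def planConst (_ : StepBounds f u c k κ a b D r) (μ ν : Measure (Euc d)) : ℝ :=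
  ∫ y, f y ∂ν + (a + b) * ∫ x, ‖x‖ ^ 2 ∂μ - a * ∫ y, ‖y‖ ^ 2 ∂ν +
    κ * ∫ p : Euc d × Euc d, Real.exp (-(a / κ * (‖p.1‖ ^ 2 + ‖p.2‖ ^ 2)))

lemma coe_lintegral_planIntegrand {ε : ℝ} (H : StepBounds f u c k (k * ε) a b D r)
    {γ : Measure (Euc d × Euc d)}
    (h₁ : IsP2 γ.fst) (h₂ : IsP2 γ.snd) (hγ : γ ≪ volume) :
    ((∫⁻ p, ENNReal.ofReal (planIntegrand f c k (k * ε) a b p (dens γ p)) : ℝ≥0∞) : EReal) =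
      k * (costInt c γ + ε * entropy γ) + H.planConst γ.fst γ.snd := by
  have hk := H.k_pos
  have hκ := H.κ_pos
  have hε : 0 < ε := pos_of_mul_pos_right hκ hk.le
  have := h₁.1
  have hfin : IsFiniteMeasure γ := ⟨by rw [← Measure.fst_univ]; exact measure_lt_top _ _⟩
  set W : Euc d × Euc d → ℝ := fun p =>
    k * c p + (f p.2 + ((a + b) * ‖p.1‖ ^ 2 - a * ‖p.2‖ ^ 2)) with hW
  have hci := H.integrable_cost h₁ h₂
  have hfi := integrable_comp_snd (H.integrable_potential h₂)
  have hxi := integrable_comp_fst h₁.integrable_norm_sq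
  have hyi := integrable_comp_snd h₂.integrable_norm_sq
  have hWi : Integrable W γ :=
    (hci.const_mul k).add (hfi.add ((hxi.const_mul (a + b)).sub (hyi.const_mul a)))
  have hWint : ∫ p, W p ∂γ = k * ∫ p, c p ∂γ + (∫ y, f y ∂γ.snd +
      ((a + b) * ∫ x, ‖x‖ ^ 2 ∂γ.fst - a * ∫ y, ‖y‖ ^ 2 ∂γ.snd)) := by
    have i₁ : Integrable (fun p : Euc d × Euc d => (a + b) * ‖p.1‖ ^ 2 - a * ‖p.2‖ ^ 2) γ :=
      (hxi.const_mul (a + b)).sub (hyi.const_mul a)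
    have i₂ : Integrable
        (fun p : Euc d × Euc d => f p.2 + ((a + b) * ‖p.1‖ ^ 2 - a * ‖p.2‖ ^ 2)) γ := hfi.add i₁
    rw [hW, integral_add (hci.const_mul k) i₂, integral_add hfi i₁,
      integral_sub (hxi.const_mul _) (hyi.const_mul _), integral_const_mul, integral_const_mul,
      integral_const_mul, integral_comp_snd (H.integrable_potential h₂),
      integral_comp_fst h₁.integrable_norm_sq, integral_comp_snd h₂.integrable_norm_sq]
  have hWd : Integrable (fun p => dens γ p * W p) volume := (integrable_rnDeriv_smul_iff hγ).2 hWi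
  have hWdint : ∫ p, dens γ p * W p = ∫ p, W p ∂γ := integral_rnDeriv_smul hγ
  have hexp := (integrable_exp_neg_mul_norm_sq_add (d := d) (div_pos H.a_pos hκ)).const_mul (k * ε)
  have hφ : Measurable fun p => dens γ p * Real.log (dens γ p) :=
    (measurable_dens γ).mul (measurable_dens γ).log
  rw [coe_lintegral_ofReal_eq hκ (Eventually.of_forall fun p => ?_)
    (Eventually.of_forall fun p => H.planIntegrand_nonneg p (dens_nonneg γ p))
    (hWd.add hexp) hφ.aestronglyMeasurable]
  · have hcost : costInt c γ = ENNReal.ofReal (∫ p, c p ∂γ) :=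
      (ofReal_integral_eq_lintegral_ofReal hci (Eventually.of_forall H.c_nonneg)).symm
    have hc0 : 0 ≤ ∫ p, c p ∂γ := integral_nonneg H.c_nonneg
    have hL : ∫ p, ((fun p => dens γ p * W p) + fun p : Euc d × Euc d =>
        k * ε * Real.exp (-(a / (k * ε) * (‖p.1‖ ^ 2 + ‖p.2‖ ^ 2)))) p =
        k * ∫ p, c p ∂γ + H.planConst γ.fst γ.snd := by
      rw [integral_add' hWd hexp, hWdint, hWint, integral_const_mul, planConst]
      ring
    rw [hL, hcost, EReal.coe_ennreal_ofReal, max_eq_left hc0, entropy]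
    by_cases hi : Integrable (fun p => dens γ p * Real.log (dens γ p)) volume
    · rw [if_pos hi, if_pos ⟨hγ, hi⟩]
      norm_cast
      ring
    · rw [if_neg hi, if_neg fun h => hi h.2, EReal.coe_mul_top_of_pos hκ,
        EReal.coe_mul_top_of_pos hε, EReal.coe_add_top, EReal.coe_add_top,
        EReal.coe_mul_top_of_pos hk, EReal.top_add_coe]
  · simp only [planIntegrand, Pi.add_apply, hW]
    field_simp
    ring

/-- The constant relating the marginal functional to the internal energy. -/
def marginalConst (_ : StepBounds f u c k κ a b D r) (ν : Measure (Euc d)) : ℝ :=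
  a + a * ∫ y, ‖y‖ ^ 2 ∂ν + D * ∫ y : Euc d, (1 + ‖y‖ ^ 2) ^ (-r)

lemma coe_lintegral_marginalIntegrand (H : StepBounds f u c k κ a b D r)
    {ν : Measure (Euc d)} (h : IsP2 ν) (hν : ν ≪ volume) :
    ((∫⁻ y, ENNReal.ofReal (marginalIntegrand u a D r y (dens ν y)) : ℝ≥0∞) : EReal) =
      internalEnergy u ν + H.marginalConst ν := by
  have := h.1
  have hWi : Integrable (fun y : Euc d => a * (1 + ‖y‖ ^ 2)) ν :=
    ((integrable_const (1 : ℝ)).add h.integrable_norm_sq).const_mul a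
  have hWd : Integrable (fun y => dens ν y * (a * (1 + ‖y‖ ^ 2))) volume :=
    (integrable_rnDeriv_smul_iff hν).2 hWi
  have hWdint : ∫ y, dens ν y * (a * (1 + ‖y‖ ^ 2)) = a + a * ∫ y, ‖y‖ ^ 2 ∂ν := by
    have e : ∫ y, dens ν y * (a * (1 + ‖y‖ ^ 2)) = ∫ y, a * (1 + ‖y‖ ^ 2) ∂ν :=
      integral_rnDeriv_smul hν
    rw [e, integral_const_mul, integral_add (integrable_const _) h.integrable_norm_sq]
    simp
    ring
  have hw : Integrable (fun y : Euc d => D * (1 + ‖y‖ ^ 2) ^ (-r)) volume := by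
    have hdim : (Module.finrank ℝ (Euc d) : ℝ) < 2 * r := by simpa using H.dim_lt
    have := (integrable_rpow_neg_one_add_norm_sq (μ := (volume : Measure (Euc d)))
      hdim).const_mul D
    rwa [show -(2 * r) / 2 = -r by ring] at this
  have hφeq : (fun y => u (max (dens ν y) 0)) = fun y => u (dens ν y) := by
    ext y
    rw [max_eq_left (dens_nonneg ν y)]
  have hφ : Measurable fun y => u (dens ν y) := by
    rw [← hφeq]
    exact H.u_cont.measurable.comp (measurable_dens ν)
  rw [coe_lintegral_ofReal_eq one_pos (Eventually.of_forall fun y => ?_)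
    (Eventually.of_forall fun y => H.marginalIntegrand_nonneg y (dens_nonneg ν y))
    (hWd.add hw) hφ.aestronglyMeasurable]
  · have hL : ∫ y, ((fun y => dens ν y * (a * (1 + ‖y‖ ^ 2))) + fun y =>
        D * (1 + ‖y‖ ^ 2) ^ (-r) : Euc d → ℝ) y = H.marginalConst ν := by
      rw [integral_add' hWd hw, hWdint, integral_const_mul, marginalConst]
    rw [hL, internalEnergy, EReal.coe_one, one_mul, add_comm]
    by_cases hi : Integrable (fun y => u (dens ν y)) volume
    · rw [if_pos hi, if_pos ⟨hν, hi⟩]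
    · rw [if_neg hi, if_neg fun h => hi h.2]
  · simp only [marginalIntegrand, Pi.add_apply, max_eq_left (dens_nonneg ν y)]
    ring

end StepBounds

end RegularisedStep

section Entropy

variable {X : Type*} [MeasureSpace X]

lemma entropy_ne_top_iff {ρ : Measure X} :
    entropy ρ ≠ ⊤ ↔ ρ ≪ volume ∧ Integrable (fun x => dens ρ x * Real.log (dens ρ x)) := by
  rw [entropy]
  split_ifs with h
  · exact ⟨fun _ => h, fun _ => EReal.coe_ne_top _⟩
  · exact ⟨fun h' => absurd rfl h', fun h' => absurd h' h⟩

lemma freeEnergy_ne_bot (f : X → ℝ) (u : ℝ → ℝ) (ρ : Measure X) : freeEnergy f u ρ ≠ ⊥ := by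
  have h₁ : potentialEnergy f ρ ≠ ⊥ := EReal.coe_ennreal_ne_bot _
  have h₂ : internalEnergy u ρ ≠ ⊥ := by
    rw [internalEnergy]
    split_ifs
    · exact EReal.coe_ne_bot _
    · exact top_ne_bot
  rw [freeEnergy, Ne, EReal.add_eq_bot_iff]
  exact not_or.2 ⟨h₁, h₂⟩

lemma integrable_dens [SigmaFinite (volume : Measure X)] {ρ : Measure X} [IsFiniteMeasure ρ] :
    Integrable (dens ρ) :=
  Measure.integrable_toReal_rnDeriv

lemma dens_prod_ae [SigmaFinite (volume : Measure X)] {ρ : Measure X} [IsFiniteMeasure ρ]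
    (hρ : ρ ≪ volume) :
    dens (ρ.prod ρ) =ᵐ[volume] fun p => dens ρ p.1 * dens ρ p.2 := by
  have hm := measurable_dens ρ
  have h : ρ.prod ρ = (volume : Measure (X × X)).withDensity
      fun p => ENNReal.ofReal (dens ρ p.1 * dens ρ p.2) := by
    conv_lhs => rw [← withDensity_ofReal_dens hρ]
    rw [prod_withDensity hm.ennreal_ofReal hm.ennreal_ofReal, Measure.volume_eq_prod]
    congr 1
    ext p
    rw [ENNReal.ofReal_mul (dens_nonneg ρ _)]
  rw [h]
  exact dens_withDensity_ofReal (X := X × X)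
    ((hm.comp measurable_fst).mul (hm.comp measurable_snd))
    fun p => mul_nonneg (dens_nonneg ρ _) (dens_nonneg ρ _)

lemma entropy_prod_self_ne_top [SigmaFinite (volume : Measure X)] {ρ : Measure X}
    [IsFiniteMeasure ρ] (h : entropy ρ ≠ ⊤) : entropy (ρ.prod ρ) ≠ ⊤ := by
  obtain ⟨hρ, hi⟩ := entropy_ne_top_iff.1 h
  refine entropy_ne_top_iff.2 ⟨hρ.prod hρ, ?_⟩
  have hint : Integrable (fun p : X × X =>
      dens ρ p.1 * Real.log (dens ρ p.1) * dens ρ p.2 +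
        dens ρ p.1 * (dens ρ p.2 * Real.log (dens ρ p.2))) :=
    (hi.mul_prod integrable_dens).add (integrable_dens.mul_prod hi)
  refine hint.congr ?_
  filter_upwards [dens_prod_ae hρ] with p hp
  rw [hp]
  rcases eq_or_ne (dens ρ p.1) 0 with h₁ | h₁
  · simp [h₁]
  rcases eq_or_ne (dens ρ p.2) 0 with h₂ | h₂
  · simp [h₂]
  rw [Real.log_mul h₁ h₂]
  ring

end Entropy

lemma ae_eq_of_lintegral_enorm_sub_eq_zero {X : Type*} [MeasurableSpace X] {m : Measure X}
    {g₁ g₂ : X → ℝ} (h₁ : Measurable g₁) (h₂ : Measurable g₂)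
    (h : ∫⁻ x, ‖g₁ x - g₂ x‖ₑ ∂m = 0) : g₁ =ᵐ[m] g₂ := by
  filter_upwards [(lintegral_eq_zero_iff (h₁.sub h₂).enorm).1 h] with x hx
  exact sub_eq_zero.1 (enorm_eq_zero.1 hx)

section MarginalCongr

variable {X Y : Type*} [MeasurableSpace X] [MeasurableSpace Y] {mX : Measure X} {mY : Measure Y}
  [SigmaFinite mX] [SigmaFinite mY] {g₁ g₂ : X × Y → ℝ}

lemma marginalSnd_congr_ae (h : g₁ =ᵐ[mX.prod mY] g₂) :
    marginalSnd mX g₁ =ᵐ[mY] marginalSnd mX g₂ := by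
  have h' : ∀ᵐ q ∂(mY.prod mX), g₁ q.swap = g₂ q.swap :=
    Measure.measurePreserving_swap.quasiMeasurePreserving.ae h
  filter_upwards [Measure.ae_ae_of_ae_prod h'] with y hy
  exact integral_congr_ae hy

lemma jointFunctional_congr_ae (E₁ : X × Y → ℝ → ℝ≥0∞) (E₂ : Y → ℝ → ℝ≥0∞)
    (h : g₁ =ᵐ[mX.prod mY] g₂) :
    jointFunctional mX mY E₁ E₂ g₁ = jointFunctional mX mY E₁ E₂ g₂ := by
  rw [jointFunctional, jointFunctional]
  congr 1
  · refine lintegral_congr_ae ?_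
    filter_upwards [h] with p hp
    rw [hp]
  · refine lintegral_congr_ae ?_
    filter_upwards [marginalSnd_congr_ae h] with y hy
    rw [hy]

end MarginalCongr

section StepMinimizer

variable {d : ℕ}

/-- The energy of a transport plan whose second marginal is the next step. -/
def planEnergy (f : Euc d → ℝ) (u : ℝ → ℝ) (c : Euc d × Euc d → ℝ) (k ε : ℝ)
    (γ : Measure (Euc d × Euc d)) : EReal :=
  k * (costInt c γ + ε * entropy γ) + freeEnergy f u γ.snd

lemma planEnergy_eq_top {f : Euc d → ℝ} {u : ℝ → ℝ} {c : Euc d × Euc d → ℝ} {k ε : ℝ}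
    (hk : 0 < k) (hε : 0 < ε) {γ : Measure (Euc d × Euc d)} (hγ : entropy γ = ⊤) :
    planEnergy f u c k ε γ = ⊤ := by
  rw [planEnergy, hγ, EReal.coe_mul_top_of_pos hε,
    EReal.add_top_of_ne_bot (EReal.coe_ennreal_ne_bot _), EReal.coe_mul_top_of_pos hk,
    EReal.top_add_of_ne_bot (freeEnergy_ne_bot f u _)]

namespace StepBounds

variable {f : Euc d → ℝ} {u : ℝ → ℝ} {c : Euc d × Euc d → ℝ} {k κ ε a b D r : ℝ}
  {μ ν : Measure (Euc d)} {γ : Measure (Euc d × Euc d)}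

/-- The energy of a plan, shifted by a constant, as a functional of its joint density. -/
def planFunctional (_ : StepBounds f u c k κ a b D r) (g : Euc d × Euc d → ℝ) : ℝ≥0∞ :=
  jointFunctional volume volume (fun p s => ENNReal.ofReal (planIntegrand f c k κ a b p s))
    (fun y s => ENNReal.ofReal (marginalIntegrand u a D r y s)) g

/-- The difference between `planFunctional` and `planEnergy`. -/
def stepConst (_ : StepBounds f u c k κ a b D r) (μ : Measure (Euc d)) : ℝ :=
  (a + b) * ∫ x, ‖x‖ ^ 2 ∂μ +
    κ * (∫ p : Euc d × Euc d, Real.exp (-(a / κ * (‖p.1‖ ^ 2 + ‖p.2‖ ^ 2)))) +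
      (a + D * ∫ y : Euc d, (1 + ‖y‖ ^ 2) ^ (-r))

lemma measurable_ofReal_planIntegrand (H : StepBounds f u c k κ a b D r) :
    Measurable fun q : (Euc d × Euc d) × ℝ =>
      ENNReal.ofReal (planIntegrand f c k κ a b q.1 q.2) :=
  H.continuous_planIntegrand.measurable.ennreal_ofReal

lemma measurable_ofReal_marginalIntegrand (H : StepBounds f u c k κ a b D r) :
    Measurable fun q : Euc d × ℝ => ENNReal.ofReal (marginalIntegrand u a D r q.1 q.2) :=
  H.continuous_marginalIntegrand.measurable.ennreal_ofReal

lemma coe_planFunctional_dens (H : StepBounds f u c k (k * ε) a b D r) (h₁ : IsP2 γ.fst)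
    (h₂ : IsP2 γ.snd) (hγ : γ ≪ volume) :
    ((H.planFunctional (dens γ) : ℝ≥0∞) : EReal) =
      planEnergy f u c k ε γ + H.stepConst γ.fst := by
  have := h₁.1
  have hfin : IsFiniteMeasure γ := ⟨by rw [← Measure.fst_univ]; exact measure_lt_top _ _⟩
  have hm : ∫⁻ y, ENNReal.ofReal (marginalIntegrand u a D r y (marginalSnd volume (dens γ) y)) =
      ∫⁻ y, ENNReal.ofReal (marginalIntegrand u a D r y (dens γ.snd y)) := by
    refine lintegral_congr_ae ?_
    filter_upwards [dens_snd_ae hγ] with y hy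
    rw [hy]
  have hpot : potentialEnergy f γ.snd = ((∫ y, f y ∂γ.snd : ℝ) : EReal) := by
    rw [potentialEnergy, ← ofReal_integral_eq_lintegral_ofReal (H.integrable_potential h₂)
      (Eventually.of_forall H.f_nonneg), EReal.coe_ennreal_ofReal,
      max_eq_left (integral_nonneg H.f_nonneg)]
  have hconst : ((H.planConst γ.fst γ.snd : ℝ) : EReal) + (H.marginalConst γ.snd : ℝ) =
      ((∫ y, f y ∂γ.snd : ℝ) : EReal) + (H.stepConst γ.fst : ℝ) := by
    norm_cast
    rw [planConst, marginalConst, stepConst]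
    ring
  rw [planFunctional, jointFunctional, hm, EReal.coe_ennreal_add, ← Measure.volume_eq_prod,
    H.coe_lintegral_planIntegrand h₁ h₂ hγ,
    H.coe_lintegral_marginalIntegrand h₂ (absolutelyContinuous_snd hγ), planEnergy, freeEnergy,
    hpot, add_add_add_comm, hconst, add_assoc, add_assoc, add_left_comm (internalEnergy u γ.snd),
    add_assoc]

lemma exists_neg_le_plan (H : StepBounds f u c k (k * ε) a b D r) (hμ : IsP2 μ) (hν : IsP2 ν) :
    ∃ q : ℝ, ∀ γ ∈ {γ : Measure (Euc d × Euc d) | IsCoupling γ μ ν},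
      (q : EReal) ≤ k * (costInt c γ + ε * entropy γ) := by
  refine ⟨-H.planConst μ ν, fun γ hγ => ?_⟩
  obtain ⟨rfl, rfl⟩ := hγ
  have hk := H.k_pos
  by_cases hac : γ ≪ volume
  · have h := H.coe_lintegral_planIntegrand hμ hν hac
    have h0 : (0 : EReal) ≤ k * (costInt c γ + ε * entropy γ) + H.planConst γ.fst γ.snd :=
      h ▸ EReal.coe_ennreal_nonneg _
    generalize (k : EReal) * (costInt c γ + ε * entropy γ) = z at h0
    induction z with
    | bot => simp at h0
    | top => exact le_top
    | coe z =>
      norm_cast at h0 ⊢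
      linarith
  · have hε : 0 < ε := pos_of_mul_pos_right H.κ_pos hk.le
    rw [entropy, if_neg fun h => hac h.1, EReal.coe_mul_top_of_pos hε,
      EReal.add_top_of_ne_bot (EReal.coe_ennreal_ne_bot _), EReal.coe_mul_top_of_pos hk]
    exact le_top

lemma M2_snd_lt_top (H : StepBounds f u c k κ a b D r) [IsFiniteMeasure γ] (hγ : γ ≪ volume)
    (h : H.planFunctional (dens γ) ≠ ⊤) : M2 γ.snd < ⊤ := by
  have hm : Measurable fun p => ENNReal.ofReal (dens γ p) := (measurable_dens γ).ennreal_ofReal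
  have hle : ENNReal.ofReal a * M2 γ.snd ≤ H.planFunctional (dens γ) := by
    refine le_trans ?_ le_self_add
    rw [M2, Measure.snd, lintegral_map (by fun_prop) measurable_snd]
    conv_lhs => rw [← withDensity_ofReal_dens hγ]
    rw [lintegral_withDensity_eq_lintegral_mul _ hm (by fun_prop),
      ← lintegral_const_mul _ (by fun_prop), ← Measure.volume_eq_prod]
    refine lintegral_mono fun p => ?_
    refine le_trans (le_of_eq ?_)
      (ENNReal.ofReal_le_ofReal (H.mul_norm_sq_le_planIntegrand p (dens_nonneg γ p)))
    have ha := H.a_pos.le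
    rw [ENNReal.ofReal_mul (by positivity), ENNReal.ofReal_mul ha,
      ENNReal.ofReal_pow (norm_nonneg _), ofReal_norm, Pi.mul_apply, mul_assoc,
      mul_comm (ENNReal.ofReal (dens γ p))]
    rfl
  refine lt_top_iff_ne_top.2 fun htop => h ?_
  rw [htop, ENNReal.mul_top (by simpa using H.a_pos)] at hle
  exact top_le_iff.1 hle

lemma exists_planFunctional_ne_top (H : StepBounds f u c k (k * ε) a b D r) (hμ : IsP2r μ)
    (hF : freeEnergy f u μ ≠ ⊤) (hE : entropy μ ≠ ⊤) :
    ∃ g, IsPlanDensity volume volume μ g ∧ H.planFunctional g ≠ ⊤ := by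
  have := hμ.1.1
  have hac : μ.prod μ ≪ volume := hμ.2.prod hμ.2
  have hfst : (μ.prod μ).fst = μ := Measure.fst_prod
  have hsnd : (μ.prod μ).snd = μ := Measure.snd_prod
  refine ⟨dens (μ.prod μ), by simpa only [hfst] using isPlanDensity_dens hac, fun htop => ?_⟩
  have h := H.coe_planFunctional_dens (γ := μ.prod μ) (by rw [hfst]; exact hμ.1)
    (by rw [hsnd]; exact hμ.1) hac
  have hcost : costInt c (μ.prod μ) ≠ ⊤ :=
    ((hasFiniteIntegral_iff_ofReal (Eventually.of_forall H.c_nonneg)).1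
      (H.integrable_cost (γ := μ.prod μ) (by rw [hfst]; exact hμ.1)
        (by rw [hsnd]; exact hμ.1)).hasFiniteIntegral).ne
  have hent := entropy_ne_top_iff.1 (entropy_prod_self_ne_top hE)
  rw [htop, planEnergy, hsnd, entropy, if_pos hent] at h
  lift costInt c (μ.prod μ) to ℝ≥0 using hcost with C hC
  have hFbot := freeEnergy_ne_bot f u μ
  lift freeEnergy f u μ to ℝ using ⟨hF, hFbot⟩ with F hF'
  have hC' : (((C : ℝ≥0) : ℝ≥0∞) : EReal) = ((C : ℝ) : EReal) := rfl
  rw [hC', EReal.coe_ennreal_top] at h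
  exact EReal.coe_ne_top _ (by exact_mod_cast h.symm)

lemma exists_optimal_plan (H : StepBounds f u c k (k * ε) a b D r) (hμ : IsP2r μ)
    (hF : freeEnergy f u μ ≠ ⊤) (hE : entropy μ ≠ ⊤) :
    ∃ γ : Measure (Euc d × Euc d), γ.fst = μ ∧ γ ≪ volume ∧ IsP2 γ.snd ∧
      H.planFunctional (dens γ) ≠ ⊤ ∧
        ∀ g, IsPlanDensity volume volume μ g → H.planFunctional (dens γ) ≤ H.planFunctional g := by
  have := hμ.1.1
  obtain ⟨g, hg, hgfin, hgmin⟩ := exists_jointFunctional_minimizer (μ := μ)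
    H.measurable_ofReal_planIntegrand H.measurable_ofReal_marginalIntegrand H.κ_pos
    (fun p => ENNReal.continuous_ofReal.comp
      (H.continuous_planIntegrand.comp (Continuous.prodMk_right p)))
    (fun y => ENNReal.continuous_ofReal.comp
      (H.continuous_marginalIntegrand.comp (Continuous.prodMk_right y)))
    H.planIntegrand_midpoint H.marginalIntegrand_midpoint
    (H.exists_planFunctional_ne_top hμ hF hE)
  set γ := (volume : Measure (Euc d × Euc d)).withDensity fun p => ENNReal.ofReal (g p) with hγ
  have hfst : γ.fst = μ := hg.fst_eq
  have hprob : IsProbabilityMeasure γ := ⟨by rw [← Measure.fst_univ, hfst]; exact measure_univ⟩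
  have hac : γ ≪ volume := withDensity_absolutelyContinuous _ _
  have hdens : dens γ =ᵐ[volume] g :=
    dens_withDensity_ofReal (X := Euc d × Euc d) hg.measurable hg.nonneg
  have hJ : H.planFunctional (dens γ) = H.planFunctional g := jointFunctional_congr_ae _ _ hdens
  have hJfin : H.planFunctional (dens γ) ≠ ⊤ := hJ ▸ hgfin
  exact ⟨γ, hfst, hac, ⟨inferInstance, H.M2_snd_lt_top hac hJfin⟩, hJfin, hJ ▸ hgmin⟩

/-- The regularised step has exactly one minimiser. -/
theorem existsUnique_minimizer (H : StepBounds f u c k (k * ε) a b D r) (hμ : IsP2r μ)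
    (hF : freeEnergy f u μ ≠ ⊤) (hE : entropy μ ≠ ⊤) :
    ∃! νs : Measure (Euc d), IsP2r νs ∧ ∀ ν : Measure (Euc d), IsP2r ν →
      (k : EReal) * transportCost c ε μ νs + freeEnergy f u νs ≤
        k * transportCost c ε μ ν + freeEnergy f u ν := by
  have := hμ.1.1
  have hk := H.k_pos
  have hε : 0 < ε := pos_of_mul_pos_right H.κ_pos hk.le
  obtain ⟨γ, hfst, hac, hP2, hfin, hmin⟩ := H.exists_optimal_plan hμ hF hE
  have hγfin : IsFiniteMeasure γ := ⟨by rw [← Measure.fst_univ, hfst]; exact measure_lt_top _ _⟩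
  set m := H.planFunctional (dens γ) with hm
  set B : ℝ := m.toReal - H.stepConst μ with hB
  have hmB : ((m : ℝ≥0∞) : EReal) = ((B + H.stepConst μ : ℝ) : EReal) := by
    rw [hB, sub_add_cancel, EReal.coe_ennreal_toReal hfin]
  have hγB : planEnergy f u c k ε γ = B := by
    have h := H.coe_planFunctional_dens (hfst ▸ hμ.1) hP2 hac
    rw [← hm, hmB, hfst] at h
    generalize planEnergy f u c k ε γ = z at h
    induction z with
    | bot => simp at h
    | top => exact absurd h (by rw [EReal.top_add_coe]; exact EReal.coe_ne_top _)
    | coe z =>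
      norm_cast at h ⊢
      linarith
  have hlower : ∀ γ' : Measure (Euc d × Euc d), γ'.fst = μ → IsP2 γ'.snd →
      (B : EReal) ≤ planEnergy f u c k ε γ' := by
    intro γ' h₁ h₂
    by_cases hac' : γ' ≪ volume
    · have hfin' : IsFiniteMeasure γ' :=
        ⟨by rw [← Measure.fst_univ, h₁]; exact measure_lt_top _ _⟩
      have hle := EReal.coe_ennreal_le_coe_ennreal_iff.2
        (hmin _ (h₁ ▸ isPlanDensity_dens hac'))
      rw [H.coe_planFunctional_dens (h₁ ▸ hμ.1) h₂ hac', h₁, hmB] at hle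
      generalize planEnergy f u c k ε γ' = z at hle
      induction z with
      | bot => simp at hle
      | top => exact le_top
      | coe z =>
        norm_cast at hle ⊢
        linarith
    · rw [planEnergy_eq_top hk hε (by rw [entropy, if_neg fun h => hac' h.1])]
      exact le_top
  have hupper : (k : EReal) * transportCost c ε μ γ.snd + freeEnergy f u γ.snd ≤ B := by
    rw [← hγB, planEnergy]
    gcongr
    exact iInf₂_le γ ⟨hfst, rfl⟩
  refine ⟨γ.snd, ⟨⟨hP2, absolutelyContinuous_snd hac⟩, fun ν hν => hupper.trans ?_⟩, ?_⟩
  · obtain ⟨q, hq⟩ := H.exists_neg_le_plan hμ.1 hν.1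
    refine EReal.coe_le_mul_iInf_add hk hq (freeEnergy_ne_bot f u ν) fun γ' hγ' => ?_
    obtain ⟨h₁, rfl⟩ := hγ'
    exact hlower γ' h₁ hν.1
  · rintro ν ⟨hν, hνmin⟩
    have hνB := (hνmin γ.snd ⟨hP2, absolutelyContinuous_snd hac⟩).trans hupper
    have hνfin := hν.1.1
    have hclose : ∀ l : ℝ, 0 < l →
        ∫⁻ y, ‖dens ν y - dens γ.snd y‖ₑ ≤ ENNReal.ofReal (4 * l) := by
      intro l hl
      have hκl : 0 < k * ε * l ^ 2 := by positivity
      obtain ⟨γ', ⟨h₁, rfl⟩, hlt⟩ :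
          ∃ γ' ∈ {γ' : Measure (Euc d × Euc d) | IsCoupling γ' μ ν},
            (k : EReal) * (costInt c γ' + ε * entropy γ') + freeEnergy f u ν <
              ((B + k * ε * l ^ 2 : ℝ) : EReal) := by
        by_contra! hcon
        obtain ⟨q, hq⟩ := H.exists_neg_le_plan hμ.1 hν.1
        have h := (EReal.coe_le_mul_iInf_add hk hq (freeEnergy_ne_bot f u ν) hcon).trans hνB
        norm_cast at h
        linarith
      change planEnergy f u c k ε γ' < _ at hlt
      have hac' : γ' ≪ volume := by
        by_contra hac'
        rw [planEnergy_eq_top hk hε (by rw [entropy, if_neg fun h => hac' h.1])] at hlt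
        exact not_top_lt hlt
      have hfin' : IsFiniteMeasure γ' :=
        ⟨by rw [← Measure.fst_univ, h₁]; exact measure_lt_top _ _⟩
      have hle : H.planFunctional (dens γ') ≤ m + ENNReal.ofReal (k * ε * l ^ 2) := by
        rw [← EReal.coe_ennreal_le_coe_ennreal_iff, EReal.coe_ennreal_add, hmB,
          EReal.coe_ennreal_ofReal, max_eq_left hκl.le,
          H.coe_planFunctional_dens (h₁ ▸ hμ.1) hν.1 hac', h₁]
        refine (add_le_add_left hlt.le _).trans (le_of_eq ?_)
        norm_cast
        ring
      have hγd : IsPlanDensity volume volume μ (dens γ) := hfst ▸ isPlanDensity_dens hac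
      have hγd' : IsPlanDensity volume volume μ (dens γ') := h₁ ▸ isPlanDensity_dens hac'
      refine le_trans (le_trans (le_of_eq ?_)
        (lintegral_enorm_marginalSnd_sub_le hγd'.integrable hγd.integrable))
        (lintegral_enorm_sub_le_of_almost_minimizer H.measurable_ofReal_planIntegrand
          H.measurable_ofReal_marginalIntegrand H.κ_pos H.planIntegrand_midpoint
          H.marginalIntegrand_midpoint hfin hmin hγd' hγd hl hle le_self_add)
      refine lintegral_congr_ae ?_
      filter_upwards [dens_snd_ae hac, dens_snd_ae hac'] with y hy hy'
      rw [hy, hy']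
    have hzero : ∫⁻ y, ‖dens ν y - dens γ.snd y‖ₑ = 0 := by
      refine le_antisymm (ENNReal.le_of_forall_pos_le_add fun e he _ => ?_) zero_le
      have h := hclose (e / 4) (by positivity)
      rwa [mul_div_cancel₀ _ four_ne_zero, ENNReal.ofReal_coe_nnreal, ← zero_add (e : ℝ≥0∞)] at h
    have hae := ae_eq_of_lintegral_enorm_sub_eq_zero (measurable_dens ν) (measurable_dens γ.snd)
      hzero
    rw [← withDensity_ofReal_dens hν.2, ← withDensity_ofReal_dens (absolutelyContinuous_snd hac)]
    refine withDensity_congr_ae ?_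
    filter_upwards [hae] with y hy
    rw [hy]

end StepBounds

end StepMinimizer

/-- Proposition 4.1, well-posedness of the regularised JKO step.
There exist `h₀, ε₀ > 0`, depending only on the constants in the assumptions, such that for
all `0 < h < h₀`, `0 < ε < ε₀` with `ε/h ≤ 1` and every `μ ∈ 𝒫₂^r(ℝ^d)` with `𝓕(μ) < ∞`
and `H(μ) < ∞`, there is a unique minimiser `ν*` of
`ν ↦ (1/2h) W_{c_h,ε}(μ,ν) + 𝓕(ν)` over `𝒫₂^r(ℝ^d)`. -/
theorem statement_0
    (d : ℕ) (f : Euc d → ℝ) (u : ℝ → ℝ) (C α : ℝ)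
    (hC : 0 < C)
    -- Assumption 2.1 (free energy)
    (hf0 : ∀ x, 0 ≤ f x) (hfc : Continuous f)
    (hfL : ∀ x y, |f x - f y| ≤ C * ‖x - y‖)
    (huconv : ConvexOn ℝ (Set.Ici 0) u)
    (huC2 : ContDiffOn ℝ 2 u (Set.Ioi 0))
    (hu0 : u 0 = 0)
    (husuper : Tendsto (fun s => u s / s) atTop atTop)
    (hα₁ : (d : ℝ) / (d + 2) < α) (hα₂ : α < 1)
    (hulb : ∀ s : ℝ, 0 ≤ s → -C * s ^ α ≤ u s)
    -- the cost family and its assumed properties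
    (c : ℝ → Euc d × Euc d → ℝ)
    (hccont : ∀ h : ℝ, 0 < h → Continuous (c h))
    (hclow : ∀ h : ℝ, 0 < h → ∀ x y : Euc d,
      ‖x - y‖ ^ 2 ≤ C * (c h (x, y) + h ^ 2 * (‖x‖ ^ 2 + ‖y‖ ^ 2)))
    (hcupper : ∀ h : ℝ, 0 < h → ∃ Ch : ℝ, 0 < Ch ∧ ∀ x y : Euc d,
      0 ≤ c h (x, y) ∧ c h (x, y) ≤ Ch * (‖x‖ ^ 2 + ‖y‖ ^ 2)) :
    ∃ h₀ > (0:ℝ), ∃ ε₀ > (0:ℝ), ∀ h ε : ℝ, 0 < h → h < h₀ → 0 < ε → ε < ε₀ → ε / h ≤ 1 →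
      ∀ μ : Measure (Euc d), IsP2r μ → freeEnergy f u μ < ⊤ → entropy μ < ⊤ →
        ∃! νs : Measure (Euc d), IsP2r νs ∧ ∀ ν : Measure (Euc d), IsP2r ν →
          ((1 / (2 * h) : ℝ) : EReal) * transportCost (c h) ε μ νs + freeEnergy f u νs ≤
            ((1 / (2 * h) : ℝ) : EReal) * transportCost (c h) ε μ ν + freeEnergy f u ν := by
  have hα : 0 < α := lt_of_le_of_lt (by positivity) hα₁
  have h1α : 0 < 1 - α := sub_pos.2 hα₂
  have hdim : (d : ℝ) < 2 * (α / (1 - α)) := by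
    rw [div_lt_iff₀ (by positivity)] at hα₁
    rw [← mul_div_assoc, lt_div_iff₀ h1α]
    linarith
  refine ⟨1 / (2 * Real.sqrt C), by positivity, 1, one_pos, ?_⟩
  intro h ε hh hlt hε _ _ μ hμ hF hE
  have hsq : 4 * C * h ^ 2 ≤ 1 := by
    rw [lt_div_iff₀ (by positivity)] at hlt
    have h₁ := pow_le_pow_left₀ (by positivity) hlt.le 2
    rw [mul_pow, mul_pow, Real.sq_sqrt hC.le] at h₁
    linarith
  obtain ⟨K, -, hK⟩ := hcupper h hh
  set k : ℝ := 1 / (2 * h) with hk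
  have hk0 : 0 < k := by positivity
  have ha0 : 0 < k / (12 * C) := by positivity
  have H : StepBounds f u (c h) k (k * ε) (k / (12 * C)) (5 * k / (4 * C))
      (C * (C / (k / (12 * C))) ^ (α / (1 - α))) (α / (1 - α)) :=
    { k_pos := hk0
      κ_pos := by positivity
      a_pos := ha0
      f_cont := hfc
      f_nonneg := hf0
      f_growth := by
        refine ⟨f 0 + C, fun x => ?_⟩
        have h₁ := (abs_le.1 (hfL x 0)).2
        rw [sub_zero] at h₁
        nlinarith [hf0 0, sq_nonneg ‖x‖, sq_nonneg (‖x‖ - 1), mul_nonneg (hf0 0) (sq_nonneg ‖x‖)]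
      c_cont := hccont h hh
      c_nonneg := fun p => (hK p.1 p.2).1
      c_growth := ⟨K, fun p => (hK p.1 p.2).2⟩
      coercive := fun p => by
        have h₁ := hclow h hh p.1 p.2
        have h₂ : ‖p.2‖ ^ 2 ≤ 2 * ‖p.1‖ ^ 2 + 2 * ‖p.1 - p.2‖ ^ 2 := by
          have h₃ : ‖p.2‖ ≤ ‖p.1‖ + ‖p.1 - p.2‖ := by
            simpa using norm_sub_le p.1 (p.1 - p.2)
          nlinarith [norm_nonneg p.2, sq_nonneg (‖p.1‖ - ‖p.1 - p.2‖)]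
        have h₄ := mul_le_mul_of_nonneg_right hsq
          (add_nonneg (sq_nonneg ‖p.1‖) (sq_nonneg ‖p.2‖))
        have h₅ : ‖p.2‖ ^ 2 ≤ 5 * ‖p.1‖ ^ 2 + 4 * C * c h p := by linarith
        have h₆ := mul_le_mul_of_nonneg_left h₅ (by positivity : 0 ≤ k / (4 * C))
        calc 3 * (k / (12 * C)) * ‖p.2‖ ^ 2 = k / (4 * C) * ‖p.2‖ ^ 2 := by
              field_simp
              ring
          _ ≤ k / (4 * C) * (5 * ‖p.1‖ ^ 2 + 4 * C * c h p) := h₆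
          _ = k * c h p + 5 * k / (4 * C) * ‖p.1‖ ^ 2 := by
              field_simp
              ring
      u_cont := continuous_comp_max_zero hα huconv hu0 hulb
      u_convex := huconv
      u_lower := fun w s hw hs => by
        have h₁ := Real.mul_rpow_le_weighted hC ha0 hw hs hα hα₂
        have h₂ := hulb s hs
        linarith
      dim_lt := hdim }
  exact H.existsUnique_minimizer hμ hF.ne hE.ne
end
end

section
/- Let D ∈ ℕ and let γ_k (k ∈ ℕ) and γ be Borel probability measures on ℝ^D with finite second moments such that γ_k converges weakly to γ and there exists C > 0 with M(γ_k) < C for all k and M(γ) < C. Then H(γ) ≤ liminf_{k→∞} H(γ_k). -/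
open MeasureTheory Filter
open scoped ENNReal NNReal RealInnerProductSpace Topology Classical

noncomputable section

/-- Young's inequality for the convex conjugate pair `a log a`, `exp (t - 1)`. -/
lemma mul_sub_exp_le_mul_log {a : ℝ} (ha : 0 ≤ a) (t : ℝ) :
    a * t - Real.exp (t - 1) ≤ a * Real.log a := by
  rcases ha.eq_or_lt with rfl | ha
  · simpa using (Real.exp_pos _).le
  · have h1 := Real.add_one_le_exp (t - 1 - Real.log a)
    have h2 : Real.exp (t - 1) = a * Real.exp (t - 1 - Real.log a) := by
      conv_rhs => rw [Real.exp_sub (t - 1), Real.exp_log ha]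
      field_simp
    rw [h2]
    nlinarith [mul_le_mul_of_nonneg_left h1 ha.le]

/-- Fatou's lemma for nonnegative real-valued functions with bounded integrals. -/
lemma integrable_and_integral_le_of_tendsto {α : Type*} [MeasurableSpace α] {μ : Measure α}
    {g : ℕ → α → ℝ} {f : α → ℝ} {B : ℝ} (hi : ∀ n, Integrable (g n) μ)
    (h0 : ∀ n x, 0 ≤ g n x) (hB : ∀ n, ∫ x, g n x ∂μ ≤ B)
    (hlim : ∀ x, Tendsto (fun n => g n x) atTop (𝓝 (f x))) :
    Integrable f μ ∧ ∫ x, f x ∂μ ≤ B := by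
  have hf0 : ∀ x, 0 ≤ f x := fun x => ge_of_tendsto' (hlim x) fun n => h0 n x
  have hfm : AEStronglyMeasurable f μ :=
    aestronglyMeasurable_of_tendsto_ae atTop (fun n => (hi n).1) (Eventually.of_forall hlim)
  have hB0 : 0 ≤ B := (integral_nonneg (h0 0)).trans (hB 0)
  have hle : ∫⁻ x, ENNReal.ofReal (f x) ∂μ ≤ ENNReal.ofReal B := by
    calc ∫⁻ x, ENNReal.ofReal (f x) ∂μ
        = ∫⁻ x, liminf (fun n => ENNReal.ofReal (g n x)) atTop ∂μ := by
          refine lintegral_congr fun x => ?_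
          exact ((ENNReal.continuous_ofReal.tendsto _).comp (hlim x)).liminf_eq.symm
      _ ≤ liminf (fun n => ∫⁻ x, ENNReal.ofReal (g n x) ∂μ) atTop :=
          lintegral_liminf_le' fun n => (hi n).1.aemeasurable.ennreal_ofReal
      _ ≤ ENNReal.ofReal B := by
          refine liminf_le_of_frequently_le' (Frequently.of_forall fun n => ?_)
          rw [← ofReal_integral_eq_lintegral_ofReal (hi n) (Eventually.of_forall (h0 n))]
          exact ENNReal.ofReal_le_ofReal (hB n)
  refine ⟨(lintegral_ofReal_ne_top_iff_integrable hfm (Eventually.of_forall hf0)).1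
    (hle.trans_lt ENNReal.ofReal_lt_top).ne, ?_⟩
  rw [integral_eq_lintegral_of_nonneg_ae (Eventually.of_forall hf0) hfm]
  exact ENNReal.toReal_le_of_le_ofReal hB0 hle

lemma integrable_exp_sub_one_sub {α : Type*} [MeasurableSpace α] {μ : Measure α} {V φ : α → ℝ}
    {R : ℝ} (hV : Integrable (fun x => Real.exp (-V x)) μ) (hφ : Measurable φ)
    (hb : ∀ x, |φ x| ≤ R) : Integrable (fun x => Real.exp (φ x - 1 - V x)) μ := by
  have h : ∀ x, Real.exp (φ x - 1 - V x) = Real.exp (φ x - 1) * Real.exp (-V x) := fun x => by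
    rw [← Real.exp_add]; ring_nf
  simp_rw [h]
  refine hV.bdd_mul (c := Real.exp R) (hφ.sub_const 1).exp.aestronglyMeasurable
    (Eventually.of_forall fun x => ?_)
  rw [Real.norm_eq_abs, abs_of_pos (Real.exp_pos _), Real.exp_le_exp]
  linarith [le_abs_self (φ x), hb x]

lemma integrable_of_abs_le {α : Type*} [MeasurableSpace α] {μ : Measure α} [IsFiniteMeasure μ]
    {φ : α → ℝ} {R : ℝ} (hφ : Measurable φ) (hb : ∀ x, |φ x| ≤ R) : Integrable φ μ :=
  Integrable.of_bound hφ.aestronglyMeasurable R (Eventually.of_forall hb)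

/-- The easy half of the variational characterisation of the entropy. -/
lemma variational_le_integral_dens_mul_log {α : Type*} [MeasureSpace α]
    [SigmaFinite (volume : Measure α)] {ρ : Measure α} [IsFiniteMeasure ρ]
    (hac : ρ ≪ (volume : Measure α))
    (hlog : Integrable (fun x => dens ρ x * Real.log (dens ρ x)) (volume : Measure α))
    {V φ : α → ℝ} {R : ℝ} (hV : Integrable (fun x => Real.exp (-V x)) (volume : Measure α))
    (hVρ : Integrable V ρ) (hφ : Measurable φ) (hb : ∀ x, |φ x| ≤ R) :
    ∫ x, φ x ∂ρ - ∫ x, V x ∂ρ - ∫ x, Real.exp (φ x - 1 - V x)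
      ≤ ∫ x, dens ρ x * Real.log (dens ρ x) := by
  have hi : Integrable (fun x => φ x - V x) ρ := (integrable_of_abs_le hφ hb).sub hVρ
  have hi' : Integrable (fun x => dens ρ x * (φ x - V x)) (volume : Measure α) :=
    (integrable_toReal_rnDeriv_mul_iff hac).2 hi
  have he := integrable_exp_sub_one_sub hV hφ hb
  have h1 : ∫ x, dens ρ x * (φ x - V x) = ∫ x, φ x ∂ρ - ∫ x, V x ∂ρ := by
    rw [← integral_sub (integrable_of_abs_le hφ hb) hVρ]
    exact integral_toReal_rnDeriv_mul hac
  rw [← h1, ← integral_sub hi' he]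
  refine integral_mono (hi'.sub he) hlog fun x => ?_
  have := mul_sub_exp_le_mul_log (ENNReal.toReal_nonneg : 0 ≤ dens ρ x) (φ x - V x)
  rwa [show φ x - V x - 1 = φ x - 1 - V x by ring] at this

/-- A variational upper bound over bounded continuous functions extends to bounded measurable
functions. -/
lemma variational_le_of_forall_boundedContinuous {α : Type*} [TopologicalSpace α]
    [TopologicalSpace.PseudoMetrizableSpace α] [MeasureSpace α] [BorelSpace α]
    {γ : Measure α} [IsFiniteMeasure γ] {V : α → ℝ} (hVm : Measurable V)
    (hV : Integrable (fun x => Real.exp (-V x)) (volume : Measure α)) {L : ℝ}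
    (hL : ∀ g : BoundedContinuousFunction α ℝ,
      ∫ x, g x ∂γ - ∫ x, Real.exp (g x - 1 - V x) ≤ L)
    {φ : α → ℝ} {R : ℝ} (hφ : Measurable φ) (hb : ∀ x, |φ x| ≤ R) :
    ∫ x, φ x ∂γ - ∫ x, Real.exp (φ x - 1 - V x) ≤ L := by
  let _ := TopologicalSpace.pseudoMetrizableSpacePseudoMetric α
  set ν : Measure α := volume.withDensity fun x => ENNReal.ofReal (Real.exp (-V x)) with hν
  have : IsFiniteMeasure ν := isFiniteMeasure_withDensity_ofReal hV.2
  have hφL : MemLp φ 1 (γ + ν) :=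
    memLp_one_iff_integrable.2 (integrable_of_abs_le hφ hb)
  choose g hg _ using fun j : ℕ => hφL.exists_boundedContinuous_eLpNorm_sub_le
    ENNReal.one_ne_top (ε := (j : ℝ≥0∞)⁻¹) (by simp)
  have hmeas : TendstoInMeasure (γ + ν) (fun j => (g j : α → ℝ)) atTop φ := by
    refine tendstoInMeasure_of_tendsto_eLpNorm one_ne_zero
      (fun j => (g j).continuous.measurable.aestronglyMeasurable) hφ.aestronglyMeasurable ?_
    refine tendsto_of_tendsto_of_tendsto_of_le_of_le tendsto_const_nhds
      ENNReal.tendsto_inv_nat_nhds_zero (fun _ => zero_le) fun j => ?_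
    rw [eLpNorm_sub_comm]
    exact hg j
  obtain ⟨ns, -, hns⟩ := hmeas.exists_seq_tendsto_ae
  rw [ae_add_measure_iff] at hns
  obtain ⟨hγ, hνae⟩ := hns
  have hvol : ∀ᵐ x, Tendsto (fun i => g (ns i) x) atTop (𝓝 (φ x)) := by
    rw [hν, ae_withDensity_iff (by fun_prop)] at hνae
    filter_upwards [hνae] with x hx
    exact hx (by simp [Real.exp_pos])
  have hclamp : ∀ (t : ℝ) (i : α), |max (-R) (min R t)| ≤ R := fun t i => by
    have hR : 0 ≤ R := (abs_nonneg _).trans (hb i)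
    rw [abs_le]
    exact ⟨le_max_left _ _, max_le (by linarith) (min_le_left _ _)⟩
  set ψ : ℕ → BoundedContinuousFunction α ℝ := fun i =>
    BoundedContinuousFunction.ofNormedAddCommGroup (fun x => max (-R) (min R (g (ns i) x)))
      (by fun_prop) R (fun x => hclamp _ x) with hψ
  have hψb : ∀ i x, |ψ i x| ≤ R := fun i x => hclamp _ x
  have hlim : ∀ x, Tendsto (fun i => g (ns i) x) atTop (𝓝 (φ x)) →
      Tendsto (fun i => ψ i x) atTop (𝓝 (φ x)) := fun x hx => by
    have h := (tendsto_const_nhds (x := -R)).max ((tendsto_const_nhds (x := R)).min hx)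
    have hbx := abs_le.1 (hb x)
    rwa [min_eq_right hbx.2, max_eq_right hbx.1] at h
  have t1 : Tendsto (fun i => ∫ x, ψ i x ∂γ) atTop (𝓝 (∫ x, φ x ∂γ)) := by
    refine tendsto_integral_of_dominated_convergence (fun _ => R)
      (fun i => (ψ i).continuous.measurable.aestronglyMeasurable) (integrable_const _)
      (fun i => Eventually.of_forall (hψb i)) ?_
    filter_upwards [hγ] with x hx using hlim x hx
  have t2 : Tendsto (fun i => ∫ x, Real.exp (ψ i x - 1 - V x)) atTop
      (𝓝 (∫ x, Real.exp (φ x - 1 - V x))) := by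
    refine tendsto_integral_of_dominated_convergence (fun x => Real.exp R * Real.exp (-V x))
      (fun i => ((((ψ i).continuous.measurable.sub_const 1).sub hVm).exp).aestronglyMeasurable)
      (hV.const_mul _) (fun i => Eventually.of_forall fun x => ?_) ?_
    · rw [Real.norm_eq_abs, abs_of_pos (Real.exp_pos _), ← Real.exp_add, Real.exp_le_exp]
      linarith [le_abs_self (ψ i x), hψb i x]
    · filter_upwards [hvol] with x hx
      exact (Real.continuous_exp.tendsto _).comp (((hlim x hx).sub_const 1).sub_const (V x))
  exact le_of_tendsto' (t1.sub t2) fun i => hL (ψ i)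

/-- A finite variational upper bound over bounded measurable functions forces absolute
continuity. -/
lemma absolutelyContinuous_of_variational_le {α : Type*} [MeasureSpace α]
    {γ : Measure α} [IsFiniteMeasure γ] {V : α → ℝ} {L : ℝ}
    (hL : ∀ (φ : α → ℝ) (R : ℝ), Measurable φ → (∀ x, |φ x| ≤ R) →
      ∫ x, φ x ∂γ - ∫ x, Real.exp (φ x - 1 - V x) ≤ L) :
    γ ≪ (volume : Measure α) := by
  refine Measure.AbsolutelyContinuous.mk fun s hs h0 => ?_
  by_contra hne
  have hpos : 0 < γ.real s := by
    rw [measureReal_def]; exact ENNReal.toReal_pos hne (measure_ne_top _ _)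
  set K := ∫ x, Real.exp (0 - 1 - V x)
  obtain ⟨n, hn⟩ := exists_nat_gt ((L + K) / γ.real s)
  have h := hL (s.indicator fun _ => (n : ℝ)) n (measurable_const.indicator hs) (fun x => by
    by_cases hx : x ∈ s <;> simp [hx])
  rw [integral_indicator_const _ hs] at h
  have hK : ∫ x, Real.exp (s.indicator (fun _ => (n : ℝ)) x - 1 - V x) = K := by
    refine integral_congr_ae ?_
    filter_upwards [measure_eq_zero_iff_ae_notMem.1 h0] with x hx
    simp [hx]
  rw [hK, smul_eq_mul] at h
  rw [div_lt_iff₀ hpos] at hn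
  linarith

/-- The truncated optimiser `1 + log r + v` of the concave function
`t ↦ r t - exp (t - 1 - v)`. -/
def truncOpt (n : ℕ) (r v : ℝ) : ℝ :=
  if r = 0 then -n else max (-n) (min n (1 + Real.log r + v))

lemma abs_truncOpt_le (n : ℕ) (r v : ℝ) : |truncOpt n r v| ≤ n := by
  have hn : (0 : ℝ) ≤ n := n.cast_nonneg
  unfold truncOpt
  split_ifs
  · simp
  · rw [abs_le]
    exact ⟨le_max_left _ _, max_le (by linarith) (min_le_left _ _)⟩

lemma truncOpt_lower_bound (n : ℕ) {r : ℝ} (hr : 0 ≤ r) (v : ℝ) :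
    0 ≤ r * truncOpt n r v - Real.exp (truncOpt n r v - 1 - v) + Real.exp (0 - 1 - v) := by
  have hn : (0 : ℝ) ≤ n := n.cast_nonneg
  rcases hr.eq_or_lt with rfl | hr
  · have : Real.exp (-n - 1 - v) ≤ Real.exp (0 - 1 - v) := Real.exp_le_exp.2 (by linarith)
    simp only [truncOpt, if_true]
    linarith
  · simp only [truncOpt, hr.ne', if_false]
    set w := 1 + Real.log r + v with hw
    set p := max (-(n : ℝ)) (min n w) with hp
    have hrw : r = Real.exp w * Real.exp (0 - 1 - v) := by
      rw [← Real.exp_add, hw, show 1 + Real.log r + v + (0 - 1 - v) = Real.log r by ring,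
        Real.exp_log hr]
    have he : Real.exp (p - 1 - v) = Real.exp p * Real.exp (0 - 1 - v) := by
      rw [← Real.exp_add]; ring_nf
    have key : Real.exp p * p ≤ Real.exp w * p := by
      rcases le_total 0 w with h | h
      · have h0 : 0 ≤ p := le_max_of_le_right (le_min hn h)
        have h1 : p ≤ w := max_le (by linarith) (min_le_right _ _)
        exact mul_le_mul_of_nonneg_right (Real.exp_le_exp.2 h1) h0
      · have h0 : p ≤ 0 := max_le (by linarith) (min_le_of_right_le h)
        have h1 : w ≤ p := le_max_of_le_right (le_min (by linarith) le_rfl)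
        exact mul_le_mul_of_nonpos_right (Real.exp_le_exp.2 h1) h0
    have h2 : Real.exp p * (1 - p) ≤ 1 := by
      have h3 := Real.add_one_le_exp (-p)
      calc Real.exp p * (1 - p) ≤ Real.exp p * Real.exp (-p) :=
            mul_le_mul_of_nonneg_left (by linarith) (Real.exp_pos _).le
        _ = 1 := by rw [← Real.exp_add]; simp
    rw [he]
    have h4 : r * p = Real.exp w * p * Real.exp (0 - 1 - v) := by rw [hrw]; ring
    rw [h4]
    nlinarith [mul_nonneg (show 0 ≤ Real.exp w * p - Real.exp p + 1 by linarith)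
      (Real.exp_pos (0 - 1 - v)).le]

lemma tendsto_truncOpt {r : ℝ} (hr : 0 ≤ r) (v : ℝ) :
    Tendsto (fun n => r * truncOpt n r v - Real.exp (truncOpt n r v - 1 - v)
      + Real.exp (0 - 1 - v)) atTop (𝓝 (r * (Real.log r + v) + Real.exp (0 - 1 - v))) := by
  refine Tendsto.add_const _ ?_
  rcases hr.eq_or_lt with rfl | hr
  · simp only [truncOpt, if_true, zero_mul, zero_sub]
    rw [← neg_zero]
    refine Tendsto.neg (Real.tendsto_exp_atBot.comp ?_)
    have : Tendsto (fun n : ℕ => -(n : ℝ)) atTop atBot :=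
      tendsto_neg_atTop_atBot.comp tendsto_natCast_atTop_atTop
    simpa [sub_eq_add_neg, add_assoc] using tendsto_atBot_add_const_right _ (-1 + -v) this
  · refine tendsto_const_nhds.congr' ?_
    obtain ⟨N, hN⟩ := exists_nat_ge |1 + Real.log r + v|
    filter_upwards [eventually_ge_atTop N] with n hn
    have hle := abs_le.1 (hN.trans (Nat.cast_le.2 hn))
    simp only [truncOpt, hr.ne', if_false]
    rw [min_eq_right hle.2, max_eq_right hle.1,
      show 1 + Real.log r + v - 1 - v = Real.log r by ring, Real.exp_log hr]
    ring

/-- The hard half of the variational characterisation of the entropy. -/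
lemma integral_dens_mul_log_le_of_variational_le {α : Type*} [MeasureSpace α]
    [SigmaFinite (volume : Measure α)] {γ : Measure α} [IsFiniteMeasure γ]
    (hac : γ ≪ (volume : Measure α)) {V : α → ℝ} (hVm : Measurable V)
    (hV : Integrable (fun x => Real.exp (-V x)) (volume : Measure α)) (hVγ : Integrable V γ)
    {L : ℝ}
    (hL : ∀ (φ : α → ℝ) (R : ℝ), Measurable φ → (∀ x, |φ x| ≤ R) →
      ∫ x, φ x ∂γ - ∫ x, Real.exp (φ x - 1 - V x) ≤ L) :
    Integrable (fun x => dens γ x * Real.log (dens γ x)) (volume : Measure α) ∧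
      (∫ x, dens γ x * Real.log (dens γ x)) + ∫ x, V x ∂γ ≤ L := by
  have hdm : Measurable (dens γ) := (Measure.measurable_rnDeriv γ volume).ennreal_toReal
  have hd0 : ∀ x, 0 ≤ dens γ x := fun x => ENNReal.toReal_nonneg
  have hφm : ∀ n : ℕ, Measurable fun x => truncOpt n (dens γ x) (V x) := fun n =>
    Measurable.ite (hdm (measurableSet_singleton 0)) measurable_const (by fun_prop)
  have hK : Integrable (fun x => Real.exp (0 - 1 - V x)) (volume : Measure α) :=
    integrable_exp_sub_one_sub (φ := fun _ => 0) (R := 0) hV measurable_const (by simp)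
  have hφi : ∀ n : ℕ, Integrable (fun x => dens γ x * truncOpt n (dens γ x) (V x))
      (volume : Measure α) := fun n =>
    (integrable_toReal_rnDeriv_mul_iff hac).2
      (integrable_of_abs_le (hφm n) fun x => abs_truncOpt_le _ _ _)
  have hei : ∀ n : ℕ, Integrable (fun x => Real.exp (truncOpt n (dens γ x) (V x) - 1 - V x))
      (volume : Measure α) := fun n =>
    integrable_exp_sub_one_sub hV (hφm n) fun x => abs_truncOpt_le _ _ _
  obtain ⟨hi, hle⟩ := integrable_and_integral_le_of_tendsto
    (B := L + ∫ x, Real.exp (0 - 1 - V x))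
    (fun n => ((hφi n).sub (hei n)).add hK)
    (fun n x => truncOpt_lower_bound n (hd0 x) (V x))
    (fun n => by
      rw [integral_add' ((hφi n).sub (hei n)) hK, integral_sub' (hφi n) (hei n)]
      have h1 : ∫ x, dens γ x * truncOpt n (dens γ x) (V x)
          = ∫ x, truncOpt n (dens γ x) (V x) ∂γ := integral_toReal_rnDeriv_mul hac
      rw [h1]
      linarith [hL _ n (hφm n) fun x => abs_truncOpt_le _ _ _])
    (fun x => tendsto_truncOpt (hd0 x) (V x))
  have hVi : Integrable (fun x => dens γ x * V x) (volume : Measure α) :=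
    (integrable_toReal_rnDeriv_mul_iff hac).2 hVγ
  have hlog : Integrable (fun x => dens γ x * Real.log (dens γ x)) (volume : Measure α) := by
    refine ((hi.sub hK).sub hVi).congr (Eventually.of_forall fun x => ?_)
    simp only [Pi.sub_apply]
    ring
  refine ⟨hlog, ?_⟩
  have h2 : ∫ x, dens γ x * V x = ∫ x, V x ∂γ := integral_toReal_rnDeriv_mul hac
  rw [← h2, ← integral_add hlog hVi]
  have hi' : Integrable (fun x => dens γ x * (Real.log (dens γ x) + V x)) (volume : Measure α) := by
    simpa only [mul_add] using hlog.fun_add hVi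
  rw [integral_add hi' hK] at hle
  simp only [mul_add] at hle
  linarith

lemma integrable_norm_sq_and_integral_le {α : Type*} [NormedAddCommGroup α] [MeasurableSpace α]
    [OpensMeasurableSpace α] {ρ : Measure α} {C : ℝ} (hC : 0 ≤ C)
    (h : M2 ρ ≤ ENNReal.ofReal C) :
    Integrable (fun x => ‖x‖ ^ 2) ρ ∧ ∫ x, ‖x‖ ^ 2 ∂ρ ≤ C := by
  have hm : AEStronglyMeasurable (fun x : α => ‖x‖ ^ 2) ρ :=
    (measurable_norm.pow_const 2).aestronglyMeasurable
  have h0 : 0 ≤ᵐ[ρ] fun x : α => ‖x‖ ^ 2 := Eventually.of_forall fun x => sq_nonneg _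
  have heq : ∫⁻ x, ENNReal.ofReal (‖x‖ ^ 2) ∂ρ = M2 ρ := by
    refine lintegral_congr fun x => ?_
    rw [ENNReal.ofReal_pow (norm_nonneg _), ofReal_norm, enorm_eq_nnnorm]
  refine ⟨(lintegral_ofReal_ne_top_iff_integrable hm h0).1 ?_, ?_⟩
  · rw [heq]; exact (h.trans_lt ENNReal.ofReal_lt_top).ne
  · rw [integral_eq_lintegral_of_nonneg_ae h0 hm, heq]
    exact ENNReal.toReal_le_of_le_ofReal hC h

lemma integrable_exp_neg_mul_norm_sq_s2 {E : Type*} [NormedAddCommGroup E] [InnerProductSpace ℝ E]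
    [FiniteDimensional ℝ E] [MeasurableSpace E] [BorelSpace E] {b : ℝ} (hb : 0 < b) :
    Integrable (fun x : E => Real.exp (-(b * ‖x‖ ^ 2))) := by
  have h := (GaussianFourier.integrable_cexp_neg_mul_sq_norm_add (V := E) (b := (b : ℂ))
    (by simpa using hb) 0 0).norm
  refine h.congr (Eventually.of_forall fun x => ?_)
  simp [Complex.norm_exp, ← Complex.ofReal_pow]

/-- Lemma 5.4, weak lower semi-continuity of the entropy under bounded
second moments. If probability measures `γ_k ⇀ γ` weakly on `ℝ^D` with uniformly bounded
second moments, then `H(γ) ≤ liminf_k H(γ_k)`. -/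
theorem statement_2
    (D : ℕ) (γs : ℕ → Measure (Euc D)) (γ : Measure (Euc D))
    (hγsprob : ∀ k, IsProbabilityMeasure (γs k)) (hγprob : IsProbabilityMeasure γ)
    (C : ℝ) (hC : 0 < C)
    (hMs : ∀ k, M2 (γs k) < ENNReal.ofReal C) (hM : M2 γ < ENNReal.ofReal C)
    (hweak : WeakTendsto γs γ) :
    entropy γ ≤ Filter.liminf (fun k => entropy (γs k)) Filter.atTop := by
  refine EReal.le_of_forall_lt_iff_le.1 fun b hb => ?_
  have hfreq : ∃ᶠ k in atTop, entropy (γs k) < b :=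
    frequently_lt_of_liminf_lt (by isBoundedDefault) hb
  have hγM := integrable_norm_sq_and_integral_le hC.le hM.le
  have key : ∀ ε : ℝ, 0 < ε → γ ≪ (volume : Measure (Euc D)) ∧
      Integrable (fun x => dens γ x * Real.log (dens γ x)) (volume : Measure (Euc D)) ∧
      ∫ x, dens γ x * Real.log (dens γ x) ≤ b + ε * C := by
    intro ε hε
    have hVm : Measurable fun x : Euc D => ε * ‖x‖ ^ 2 := by fun_prop
    have hV : Integrable (fun x : Euc D => Real.exp (-(ε * ‖x‖ ^ 2))) :=
      integrable_exp_neg_mul_norm_sq_s2 hε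
    have hL : ∀ g : BoundedContinuousFunction (Euc D) ℝ,
        ∫ x, g x ∂γ - ∫ x, Real.exp (g x - 1 - ε * ‖x‖ ^ 2) ≤ b + ε * C := by
      intro g
      refine le_of_tendsto_of_frequently ((hweak g).sub_const _) (hfreq.mono fun k hk => ?_)
      have hkM := integrable_norm_sq_and_integral_le hC.le (hMs k).le
      unfold entropy at hk
      split_ifs at hk with hk'
      · have h1 := variational_le_integral_dens_mul_log hk'.1 hk'.2 hV (hkM.1.const_mul ε)
          g.continuous.measurable g.norm_coe_le_norm
        rw [integral_const_mul] at h1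
        have h2 := mul_le_mul_of_nonneg_left hkM.2 hε.le
        have h3 := EReal.coe_lt_coe_iff.1 hk
        linarith
      · exact absurd hk not_top_lt
    have hL' := fun (φ : Euc D → ℝ) (R : ℝ) (hφ : Measurable φ) (hb : ∀ x, |φ x| ≤ R) =>
      variational_le_of_forall_boundedContinuous hVm hV hL hφ hb
    have hac := absolutelyContinuous_of_variational_le hL'
    obtain ⟨hlog, hle⟩ :=
      integral_dens_mul_log_le_of_variational_le hac hVm hV (hγM.1.const_mul ε) hL'
    have h0 : 0 ≤ ∫ x, ε * ‖x‖ ^ 2 ∂γ := integral_nonneg fun x => by positivity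
    exact ⟨hac, hlog, by linarith⟩
  obtain ⟨hac, hlog, -⟩ := key 1 one_pos
  rw [entropy, if_pos ⟨hac, hlog⟩, EReal.coe_le_coe_iff]
  refine le_of_forall_pos_le_add fun δ hδ => ?_
  simpa [div_mul_cancel₀ _ hC.ne'] using (key (δ / C) (by positivity)).2.2
end
end

section
/- Let c : ℝ^d × ℝ^d → ℝ be continuous with 0 ≤ c(x,y) ≤ C₁(‖x‖² + ‖y‖²) for all x, y ∈ ℝ^d and some C₁ > 0, and let ε > 0. Let μ, ν ∈ 𝒫₂^r(ℝ^d) with H(μ) < ∞ and H(ν) < ∞. Then W_{c,ε}(μ,ν) < ∞ and there exists γ ∈ Π^r(μ,ν) attaining the infimum: W_{c,ε}(μ,ν) = (c,γ) + ε H(γ). -/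
open MeasureTheory Filter
open scoped ENNReal NNReal RealInnerProductSpace Topology Classical

noncomputable section

open InformationTheory in
lemma klFun_midpoint_add_le {a b : ℝ} (ha : 0 ≤ a) (hb : 0 ≤ b) :
    2 * klFun ((a + b) / 2) + (√a - √b) ^ 2 / 2 ≤ klFun a + klFun b := by
  have key : ∀ t m : ℝ, 0 ≤ t → 0 < m →
      t * Real.log m + t - m + (√t - √m) ^ 2 ≤ t * Real.log t := by
    intro t m ht hm
    rcases ht.eq_or_lt with rfl | ht
    · simp [Real.sq_sqrt hm.le]
    have hst := Real.sqrt_pos.2 ht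
    have hsm := Real.sqrt_pos.2 hm
    have h1 := Real.log_le_sub_one_of_pos (div_pos hsm hst)
    rw [Real.log_div hsm.ne' hst.ne', Real.log_sqrt hm.le, Real.log_sqrt ht.le] at h1
    have h2 : t * (√m / √t) = √t * √m := by
      rw [mul_div_assoc', div_eq_iff hst.ne']
      nlinarith [Real.sq_sqrt ht.le]
    have h3 := mul_le_mul_of_nonneg_left h1 ht.le
    nlinarith [Real.sq_sqrt ht.le, Real.sq_sqrt hm.le]
  rcases (add_nonneg ha hb).eq_or_lt with h | h
  · obtain rfl : a = 0 := by linarith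
    obtain rfl : b = 0 := by linarith
    simp [klFun_apply]
    norm_num
  · have hm : 0 < (a + b) / 2 := by linarith
    have h1 := key a _ ha hm
    have h2 := key b _ hb hm
    simp only [klFun_apply]
    nlinarith [sq_nonneg (√a + √b - 2 * √((a + b) / 2))]

/-- The entropic cost `∫ (c f + ε klFun f) dπ` of a density `f`. -/
def densityCost {X : Type*} [MeasurableSpace X] (π : Measure X) (c : X → ℝ) (ε : ℝ)
    (f : X → ℝ) : ℝ≥0∞ :=
  ∫⁻ x, ENNReal.ofReal (c x * f x + ε * InformationTheory.klFun (f x)) ∂π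

section

variable {X : Type*} [MeasurableSpace X] {π : Measure X} {c : X → ℝ} {ε : ℝ}

lemma two_mul_densityCost_midpoint_add_le (hc : Measurable c) (hc0 : ∀ x, 0 ≤ c x)
    (hε : 0 < ε) {f g : X → ℝ} (hf : Measurable f) (hg : Measurable g)
    (hf0 : ∀ x, 0 ≤ f x) (hg0 : ∀ x, 0 ≤ g x) :
    2 * densityCost π c ε (fun x => (f x + g x) / 2) +
      ENNReal.ofReal (ε / 2) * ∫⁻ x, ENNReal.ofReal ((√(f x) - √(g x)) ^ 2) ∂π ≤
      densityCost π c ε f + densityCost π c ε g := by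
  have hk := InformationTheory.measurable_klFun
  unfold densityCost
  rw [← lintegral_const_mul _ (by fun_prop), ← lintegral_const_mul _ (by fun_prop),
    ← lintegral_add_left (by fun_prop), ← lintegral_add_left (by fun_prop)]
  refine lintegral_mono fun x => ?_
  have hm : 0 ≤ (f x + g x) / 2 := by linarith [hf0 x, hg0 x]
  have n0 := InformationTheory.klFun_nonneg hm
  have n1 := InformationTheory.klFun_nonneg (hf0 x)
  have n2 := InformationTheory.klFun_nonneg (hg0 x)
  have c0 := mul_nonneg (hc0 x) (hf0 x)
  have c1 := mul_nonneg (hc0 x) (hg0 x)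
  have c2 := mul_nonneg (hc0 x) hm
  have key := mul_le_mul_of_nonneg_left (klFun_midpoint_add_le (hf0 x) (hg0 x)) hε.le
  rw [← ENNReal.ofReal_ofNat 2, ← ENNReal.ofReal_mul (by norm_num),
    ← ENNReal.ofReal_mul (by positivity), ← ENNReal.ofReal_add (by positivity) (by positivity),
    ← ENNReal.ofReal_add (by positivity) (by positivity)]
  refine ENNReal.ofReal_le_ofReal ?_
  nlinarith

lemma densityCost_le_of_tendsto_ae (hc : Measurable c) {u : ℕ → X → ℝ}
    {f : X → ℝ} (hu : ∀ n, Measurable (u n))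
    (hlim : ∀ᵐ x ∂π, Tendsto (fun n => u n x) atTop (𝓝 (f x))) {m : ℝ≥0∞}
    (hm : Tendsto (fun n => densityCost π c ε (u n)) atTop (𝓝 m)) :
    densityCost π c ε f ≤ m := by
  have hk := InformationTheory.measurable_klFun
  calc densityCost π c ε f
      = ∫⁻ x, liminf (fun n => ENNReal.ofReal
          (c x * u n x + ε * InformationTheory.klFun (u n x))) atTop ∂π := by
        refine lintegral_congr_ae ?_
        filter_upwards [hlim] with x hx
        refine (Tendsto.liminf_eq ?_).symm
        exact ENNReal.tendsto_ofReal ((hx.const_mul _).add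
          (((InformationTheory.continuous_klFun.tendsto _).comp hx).const_mul _))
    _ ≤ liminf (fun n => densityCost π c ε (u n)) atTop :=
        lintegral_liminf_le fun n => by have := hu n; fun_prop
    _ = m := hm.liminf_eq

lemma eLpNorm_two_sq (f : X → ℝ) :
    eLpNorm f 2 π ^ 2 = ∫⁻ x, ENNReal.ofReal (f x ^ 2) ∂π := by
  have h := eLpNorm_nnreal_pow_eq_lintegral (f := f) (μ := π) (p := 2) two_ne_zero
  norm_num at h
  rw [h]
  refine lintegral_congr fun x => ?_
  rw [← enorm_pow, Real.enorm_eq_ofReal (sq_nonneg _)]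

/-- The entropic cost attains its minimum on a midpoint convex set of densities that is closed
for the Hellinger distance. -/
theorem exists_forall_densityCost_le [IsFiniteMeasure π] (hc : Measurable c)
    (hc0 : ∀ x, 0 ≤ c x) (hε : 0 < ε)
    {K : Set (X → ℝ)} (hne : K.Nonempty)
    (hK : ∀ f ∈ K, Measurable f ∧ (∀ x, 0 ≤ f x) ∧ ∫⁻ x, ENNReal.ofReal (f x) ∂π ≠ ⊤)
    (hmid : ∀ f ∈ K, ∀ g ∈ K, (fun x => (f x + g x) / 2) ∈ K)
    (hclosed : ∀ (u : ℕ → X → ℝ) (g : X → ℝ), (∀ n, u n ∈ K) → Measurable g → (∀ x, 0 ≤ g x) →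
      Tendsto (fun n => eLpNorm (fun x => √(u n x) - g x) 2 π) atTop (𝓝 0) →
      (fun x => g x ^ 2) ∈ K) :
    ∃ f ∈ K, ∀ g ∈ K, densityCost π c ε f ≤ densityCost π c ε g := by
  set m : ℝ≥0∞ := ⨅ g ∈ K, densityCost π c ε g with hmdef
  have hm_le : ∀ g ∈ K, m ≤ densityCost π c ε g := fun g hg => iInf₂_le g hg
  suffices h : ∃ f ∈ K, densityCost π c ε f ≤ m by
    obtain ⟨f, hf, hfm⟩ := h
    exact ⟨f, hf, fun g hg => hfm.trans (hm_le g hg)⟩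
  by_cases hmtop : m = ⊤
  · obtain ⟨f, hf⟩ := hne
    exact ⟨f, hf, hmtop ▸ le_top⟩
  set δ : ℕ → ℝ := fun n => ε / 8 * (1 / 4) ^ n with hδ
  have hδpos : ∀ n, 0 < δ n := fun n => by positivity
  have hδanti : Antitone δ := fun i j hij =>
    mul_le_mul_of_nonneg_left (pow_le_pow_of_le_one (by norm_num) (by norm_num) hij) (by positivity)
  have hex : ∀ n, ∃ f ∈ K, densityCost π c ε f < m + ENNReal.ofReal (δ n) := by
    intro n
    have : m < m + ENNReal.ofReal (δ n) :=
      ENNReal.lt_add_right hmtop (by simpa using hδpos n)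
    simpa only [hmdef, iInf_lt_iff, exists_prop] using this
  choose u huK hu using hex
  have humeas := fun n => (hK _ (huK n)).1
  have hu0 := fun n => (hK _ (huK n)).2.1
  have hL2 : ∀ n, MemLp (fun x => √(u n x)) 2 π := by
    intro n
    have := humeas n
    refine ⟨by fun_prop, ?_⟩
    have h := eLpNorm_two_sq (π := π) (fun x => √(u n x))
    simp only [Real.sq_sqrt (hu0 n _)] at h
    have h' := (hK _ (huK n)).2.2
    rw [← h] at h'
    exact lt_top_iff_ne_top.2 fun ht => h' (by simp [ht])
  have hcau : ∀ N n k : ℕ, N ≤ n → N ≤ k →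
      eLpNorm ((fun x => √(u n x)) - fun x => √(u k x)) 2 π < ENNReal.ofReal ((1 / 2) ^ N) := by
    intro N n k hn hk
    have h1 := two_mul_densityCost_midpoint_add_le (π := π) hc hc0 hε (humeas n) (humeas k)
      (hu0 n) (hu0 k)
    have h2 := hm_le _ (hmid _ (huK n) _ (huK k))
    set D := ∫⁻ x, ENNReal.ofReal ((√(u n x) - √(u k x)) ^ 2) ∂π with hD
    have hle : ∀ i, N ≤ i → densityCost π c ε (u i) ≤ m + ENNReal.ofReal (δ N) := fun i hi =>
      (hu i).le.trans (by gcongr; exact hδanti hi)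
    have h3 : 2 * m + ENNReal.ofReal (ε / 2) * D ≤ 2 * m + 2 * ENNReal.ofReal (δ N) := by
      calc 2 * m + ENNReal.ofReal (ε / 2) * D ≤ _ := by gcongr
        _ ≤ _ := h1
        _ ≤ _ := add_le_add (hle n hn) (hle k hk)
        _ = _ := by ring
    have h4 := (ENNReal.add_le_add_iff_left (ENNReal.mul_ne_top (by simp) hmtop)).1 h3
    have h5 : ENNReal.ofReal (ε / 2) * D <
        ENNReal.ofReal (ε / 2) * ENNReal.ofReal ((1 / 2) ^ N) ^ 2 := by
      refine h4.trans_lt ?_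
      rw [← ENNReal.ofReal_pow (by positivity), ← ENNReal.ofReal_mul (by positivity),
        ← ENNReal.ofReal_ofNat 2, ← ENNReal.ofReal_mul (by positivity),
        ENNReal.ofReal_lt_ofReal_iff (by positivity), ← pow_mul, mul_comm N 2, pow_mul]
      have : (0 : ℝ) < ε * (1 / 4) ^ N := by positivity
      have h14 : ((1 / 2 : ℝ) ^ 2) ^ N = (1 / 4) ^ N := by norm_num
      rw [h14]
      simp only [hδ]
      linarith
    have h6 : D < ENNReal.ofReal ((1 / 2) ^ N) ^ 2 := lt_of_mul_lt_mul_left' h5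
    rw [hD, ← eLpNorm_two_sq] at h6
    exact lt_of_pow_lt_pow_left' 2 h6
  obtain ⟨g₀, hg₀, hlim₀⟩ := Lp.cauchy_complete_eLpNorm one_le_two hL2
    (B := fun N => ENNReal.ofReal ((1 / 2) ^ N))
    (by
      rw [← ENNReal.ofReal_tsum_of_nonneg (fun _ => by positivity) summable_geometric_two]
      exact ENNReal.ofReal_ne_top) hcau
  obtain ⟨g₁, hg₁, hg₀₁⟩ := hg₀.1
  have hlim : Tendsto (fun n => eLpNorm (fun x => √(u n x) - |g₁ x|) 2 π) atTop (𝓝 0) := by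
    refine tendsto_of_tendsto_of_tendsto_of_le_of_le tendsto_const_nhds hlim₀
      (fun _ => zero_le) fun n => eLpNorm_mono_ae ?_
    filter_upwards [hg₀₁] with x hx
    simp only [Pi.sub_apply, hx, Real.norm_eq_abs]
    conv_lhs => rw [← abs_of_nonneg (Real.sqrt_nonneg (u n x))]
    exact abs_abs_sub_abs_le _ _
  have hg₁m : Measurable fun x => |g₁ x| := hg₁.measurable.abs
  refine ⟨_, hclosed u _ huK hg₁m (fun x => abs_nonneg _) hlim, ?_⟩
  obtain ⟨ns, hns, hae⟩ := (tendstoInMeasure_of_tendsto_eLpNorm (g := fun x => |g₁ x|)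
    two_ne_zero (fun n => (hL2 n).1) hg₁m.aestronglyMeasurable hlim).exists_seq_tendsto_ae
  refine densityCost_le_of_tendsto_ae hc (u := fun i => u (ns i)) (fun i => humeas _) ?_
    (Tendsto.comp (g := fun n => densityCost π c ε (u n)) ?_ hns.tendsto_atTop)
  · filter_upwards [hae] with x hx
    simpa only [Real.sq_sqrt (hu0 _ _)] using hx.pow 2
  · have hδ0 : Tendsto δ atTop (𝓝 0) := by
      simpa [hδ] using (tendsto_pow_atTop_nhds_zero_of_lt_one (r := (1 / 4 : ℝ)) (by norm_num)
        (by norm_num)).const_mul (ε / 8)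
    refine tendsto_of_tendsto_of_tendsto_of_le_of_le tendsto_const_nhds ?_
      (fun n => hm_le _ (huK n)) (fun n => (hu n).le)
    simpa using (tendsto_const_nhds (x := m)).add (ENNReal.tendsto_ofReal hδ0)

end

section

variable {α : Type*} [MeasurableSpace α] {μ ν : Measure α} {γ : Measure (α × α)}

lemma IsCoupling.ae_fst (hγ : IsCoupling γ μ ν) {p : α → Prop} (h : ∀ᵐ x ∂μ, p x) :
    ∀ᵐ z ∂γ, p z.1 := by
  rw [← hγ.1] at h
  exact ae_of_ae_map measurable_fst.aemeasurable h

lemma IsCoupling.ae_snd (hγ : IsCoupling γ μ ν) {p : α → Prop} (h : ∀ᵐ x ∂ν, p x) :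
    ∀ᵐ z ∂γ, p z.2 := by
  rw [← hγ.2] at h
  exact ae_of_ae_map measurable_snd.aemeasurable h

lemma IsCoupling.isProbabilityMeasure [IsProbabilityMeasure μ] (hγ : IsCoupling γ μ ν) :
    IsProbabilityMeasure γ :=
  ⟨by rw [← Measure.fst_univ, hγ.1, measure_univ]⟩

lemma ae_toReal_rnDeriv_pos [SigmaFinite μ] [SigmaFinite ν] (h : μ ≪ ν) :
    ∀ᵐ x ∂μ, 0 < (μ.rnDeriv ν x).toReal := by
  filter_upwards [Measure.rnDeriv_pos h, h.ae_le (Measure.rnDeriv_lt_top μ ν)] with x h1 h2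
  exact ENNReal.toReal_pos h1.ne' h2.ne

end

section

variable {α : Type*} [MeasureSpace α]

lemma entropy_of_absolutelyContinuous {ρ : Measure α} [SigmaFinite (volume : Measure α)]
    [IsFiniteMeasure ρ] (h : ρ ≪ volume) :
    entropy ρ = if Integrable (fun x => Real.log (dens ρ x)) ρ
      then ((∫ x, Real.log (dens ρ x) ∂ρ : ℝ) : EReal) else ⊤ := by
  have h1 := integrable_rnDeriv_smul_iff h (f := fun x => Real.log (dens ρ x))
  have h2 := integral_rnDeriv_smul h (f := fun x => Real.log (dens ρ x))
  simp only [smul_eq_mul] at h1 h2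
  simp only [entropy, h, true_and, ← h1, ← h2]
  rfl

variable [SigmaFinite (volume : Measure α)] {μ ν : Measure α} {γ : Measure (α × α)}

lemma prod_eq_withDensity [IsFiniteMeasure μ] [IsFiniteMeasure ν]
    (hμ : μ ≪ volume) (hν : ν ≪ volume) :
    μ.prod ν = (volume : Measure (α × α)).withDensity
      fun z => μ.rnDeriv volume z.1 * ν.rnDeriv volume z.2 := by
  conv_lhs => rw [← Measure.withDensity_rnDeriv_eq μ volume hμ,
    ← Measure.withDensity_rnDeriv_eq ν volume hν]
  rw [prod_withDensity (Measure.measurable_rnDeriv _ _) (Measure.measurable_rnDeriv _ _)]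
  rfl

lemma IsCoupling.absolutelyContinuous_prod [IsFiniteMeasure μ] [IsFiniteMeasure ν]
    (hμ : μ ≪ volume) (hν : ν ≪ volume) (hγ : IsCoupling γ μ ν) (hac : γ ≪ volume) :
    γ ≪ μ.prod ν := by
  intro s hs
  rw [prod_eq_withDensity hμ hν, withDensity_apply_eq_zero (by fun_prop)] at hs
  have h1 : ∀ᵐ z ∂γ, z ∉ {z : α × α | μ.rnDeriv volume z.1 * ν.rnDeriv volume z.2 ≠ 0} ∩ s :=
    measure_eq_zero_iff_ae_notMem.1 (hac hs)
  rw [measure_eq_zero_iff_ae_notMem]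
  filter_upwards [h1, hγ.ae_fst (Measure.rnDeriv_pos hμ), hγ.ae_snd (Measure.rnDeriv_pos hν)]
    with z hz hz1 hz2 hzs
  exact hz ⟨mul_ne_zero hz1.ne' hz2.ne', hzs⟩

lemma IsCoupling.ae_log_dens_eq [IsFiniteMeasure μ] [IsFiniteMeasure ν] [IsFiniteMeasure γ]
    (hμ : μ ≪ volume) (hν : ν ≪ volume) (hγ : IsCoupling γ μ ν) (hac : γ ≪ volume) :
    ∀ᵐ z ∂γ, Real.log (dens γ z) =
      llr γ (μ.prod ν) z + (Real.log (dens μ z.1) + Real.log (dens ν z.2)) := by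
  have hπ := hγ.absolutelyContinuous_prod hμ hν hac
  have h1 := hac.ae_le (Measure.rnDeriv_mul_rnDeriv (κ := (volume : Measure (α × α))) hπ)
  have h2 : ∀ᵐ z ∂γ, (μ.prod ν).rnDeriv volume z =
      μ.rnDeriv volume z.1 * ν.rnDeriv volume z.2 := by
    refine hac.ae_le ?_
    rw [prod_eq_withDensity hμ hν]
    exact Measure.rnDeriv_withDensity _ (by fun_prop)
  filter_upwards [h1, h2, hγ.ae_fst (ae_toReal_rnDeriv_pos hμ),
    hγ.ae_snd (ae_toReal_rnDeriv_pos hν), ae_toReal_rnDeriv_pos hπ]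
    with z hz1 hz2 hzμ hzν hzγ
  simp only [dens, llr]
  rw [← hz1, Pi.mul_apply, hz2, ENNReal.toReal_mul, ENNReal.toReal_mul,
    Real.log_mul hzγ.ne' (by positivity), Real.log_mul hzμ.ne' hzν.ne']

lemma integrable_log_dens {ρ : Measure α} [IsFiniteMeasure ρ] (h : ρ ≪ volume)
    (hH : entropy ρ < ⊤) : Integrable (fun x => Real.log (dens ρ x)) ρ := by
  rw [entropy_of_absolutelyContinuous h] at hH
  by_contra hn
  simp [hn] at hH

/-- The entropy of a coupling is its relative entropy with respect to the independent coupling,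
up to a constant that depends only on the marginals. -/
lemma IsCoupling.entropy_eq [IsProbabilityMeasure μ] [IsProbabilityMeasure ν]
    (hμ : μ ≪ volume) (hν : ν ≪ volume) (hHμ : entropy μ < ⊤) (hHν : entropy ν < ⊤)
    (hγ : IsCoupling γ μ ν) (hac : γ ≪ volume) :
    entropy γ = (InformationTheory.klDiv γ (μ.prod ν) : EReal) +
      ((∫ x, Real.log (dens μ x) ∂μ + ∫ x, Real.log (dens ν x) ∂ν : ℝ) : EReal) := by
  have := hγ.isProbabilityMeasure
  have hπ := hγ.absolutelyContinuous_prod hμ hν hac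
  have hlog := hγ.ae_log_dens_eq hμ hν hac
  have hiμ := integrable_log_dens hμ hHμ
  have hiν := integrable_log_dens hν hHν
  obtain ⟨h1, h2⟩ := hγ
  rw [← h1] at hiμ
  rw [← h2] at hiν
  have hjμ : Integrable (fun z : α × α => Real.log (dens μ z.1)) γ := by
    rw [← h1]; exact hiμ.comp_measurable measurable_fst
  have hjν : Integrable (fun z : α × α => Real.log (dens ν z.2)) γ := by
    rw [← h2]; exact hiν.comp_measurable measurable_snd
  have eμ : ∫ x, Real.log (dens μ x) ∂μ = ∫ z, Real.log (dens μ z.1) ∂γ := by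
    rw [← h1]
    exact integral_map measurable_fst.aemeasurable hiμ.1
  have eν : ∫ x, Real.log (dens ν x) ∂ν = ∫ z, Real.log (dens ν z.2) ∂γ := by
    rw [← h2]
    exact integral_map measurable_snd.aemeasurable hiν.1
  have hi_iff : Integrable (fun z => Real.log (dens γ z)) γ ↔
      Integrable (llr γ (μ.prod ν)) γ := by
    rw [integrable_congr hlog]
    exact integrable_add_iff_integrable_left (hjμ.add hjν)
  have hsum : Integrable
      (fun z : α × α => Real.log (dens μ z.1) + Real.log (dens ν z.2)) γ := hjμ.add hjν
  rw [entropy_of_absolutelyContinuous hac, hi_iff]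
  split_ifs with hi
  · have hk := InformationTheory.toReal_klDiv_of_measure_eq hπ (by simp)
    have hfin := InformationTheory.klDiv_ne_top hπ hi
    rw [integral_congr_ae hlog, integral_add hi hsum, integral_add hjμ hjν, ← hk,
      ← eμ, ← eν, EReal.coe_add, EReal.coe_ennreal_toReal hfin]
  · rw [InformationTheory.klDiv_of_not_integrable hi, EReal.coe_ennreal_top, EReal.top_add_coe]

end

lemma coe_add_mul_coe_add (a b : ℝ≥0∞) {ε : ℝ} (hε : 0 < ε) (H : ℝ) :
    (a : EReal) + ε * ((b : EReal) + H) =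
      ((a + ENNReal.ofReal ε * b : ℝ≥0∞) : EReal) + ((ε * H : ℝ) : EReal) := by
  have hε' : ENNReal.ofReal ε ≠ 0 := by simpa using hε
  induction b with
  | top =>
    rw [ENNReal.mul_top hε', add_top, EReal.coe_ennreal_top, EReal.top_add_coe,
      EReal.coe_mul_top_of_pos hε, EReal.top_add_coe, EReal.add_top_of_ne_bot (by simp)]
  | coe b =>
    induction a with
    | top =>
      rw [top_add, EReal.coe_ennreal_top, EReal.top_add_coe]
      exact EReal.top_add_coe (ε * (b + H))
    | coe a =>
      rw [EReal.coe_ennreal_add, EReal.coe_ennreal_mul, EReal.coe_ennreal_ofReal,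
        max_eq_left hε.le, EReal.coe_nnreal_eq_coe_real, EReal.coe_nnreal_eq_coe_real]
      have : (a : ℝ) + ε * (b + H) = a + ε * b + ε * H := by ring
      exact_mod_cast congrArg Real.toEReal this

section

variable {α : Type*} [MeasurableSpace α] {μ ν : Measure α} {c : α × α → ℝ} {ε : ℝ}

lemma isCoupling_iff_forall {γ : Measure (α × α)} :
    IsCoupling γ μ ν ↔ (∀ s, MeasurableSet s → γ (Prod.fst ⁻¹' s) = μ s) ∧
      ∀ s, MeasurableSet s → γ (Prod.snd ⁻¹' s) = ν s := by
  rw [IsCoupling, Measure.ext_iff, Measure.ext_iff]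
  exact and_congr
    (forall₂_congr fun s hs => by rw [Measure.fst_apply hs])
    (forall₂_congr fun s hs => by rw [Measure.snd_apply hs])

/-- The nonnegative densities with respect to `μ ⊗ ν` of couplings of `μ` and `ν`. -/
def couplingDensities (μ ν : Measure α) : Set (α × α → ℝ) :=
  {f | Measurable f ∧ (∀ z, 0 ≤ f z) ∧
    IsCoupling ((μ.prod ν).withDensity fun z => ENNReal.ofReal (f z)) μ ν}

lemma densityCost_eq [IsProbabilityMeasure μ] [IsProbabilityMeasure ν]
    (hc : Measurable c) (hc0 : ∀ z, 0 ≤ c z) (hε : 0 < ε) {f : α × α → ℝ}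
    (hf : f ∈ couplingDensities μ ν) :
    densityCost (μ.prod ν) c ε f =
      costInt c ((μ.prod ν).withDensity fun z => ENNReal.ofReal (f z)) + ENNReal.ofReal ε *
        InformationTheory.klDiv ((μ.prod ν).withDensity fun z => ENNReal.ofReal (f z))
          (μ.prod ν) := by
  obtain ⟨hfm, hf0, hγ⟩ := hf
  have hk := InformationTheory.measurable_klFun
  have := hγ.isProbabilityMeasure
  rw [InformationTheory.klDiv_eq_lintegral_klFun_of_ac (withDensity_absolutelyContinuous _ _),
    costInt, lintegral_withDensity_eq_lintegral_mul _ (by fun_prop) (by fun_prop), densityCost,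
    ← lintegral_const_mul _ (by fun_prop), ← lintegral_add_left (by fun_prop)]
  refine lintegral_congr_ae ?_
  filter_upwards [Measure.rnDeriv_withDensity (μ.prod ν)
    (f := fun z => ENNReal.ofReal (f z)) (by fun_prop)] with z hz
  rw [hz, ENNReal.toReal_ofReal (hf0 z), Pi.mul_apply, ← ENNReal.ofReal_mul (hf0 z),
    ← ENNReal.ofReal_mul hε.le, mul_comm (c z)]
  exact ENNReal.ofReal_add (mul_nonneg (hf0 z) (hc0 z))
    (mul_nonneg hε.le (InformationTheory.klFun_nonneg (hf0 z)))

lemma IsCoupling.exists_density [IsProbabilityMeasure μ] [IsProbabilityMeasure ν]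
    {γ : Measure (α × α)} (hγ : IsCoupling γ μ ν) (hac : γ ≪ μ.prod ν) :
    ∃ f ∈ couplingDensities μ ν, (μ.prod ν).withDensity (fun z => ENNReal.ofReal (f z)) = γ := by
  have := hγ.isProbabilityMeasure
  have h : (μ.prod ν).withDensity
      (fun z => ENNReal.ofReal (γ.rnDeriv (μ.prod ν) z).toReal) = γ := by
    conv_rhs => rw [← Measure.withDensity_rnDeriv_eq γ _ hac]
    refine withDensity_congr_ae ?_
    filter_upwards [Measure.rnDeriv_lt_top γ (μ.prod ν)] with z hz
    exact ENNReal.ofReal_toReal hz.ne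
  refine ⟨fun z => (γ.rnDeriv (μ.prod ν) z).toReal, ⟨by fun_prop, fun z => by positivity, ?_⟩, h⟩
  rwa [h]

lemma withDensity_midpoint_apply {X : Type*} [MeasurableSpace X] {π : Measure X} {f g : X → ℝ}
    (hf : Measurable f) (hg : Measurable g) (hf0 : ∀ z, 0 ≤ f z) (hg0 : ∀ z, 0 ≤ g z)
    {s : Set X} (hs : MeasurableSet s) :
    π.withDensity (fun z => ENNReal.ofReal ((f z + g z) / 2)) s =
      2⁻¹ * (π.withDensity (fun z => ENNReal.ofReal (f z)) s +
        π.withDensity (fun z => ENNReal.ofReal (g z)) s) := by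
  rw [withDensity_apply _ hs, withDensity_apply _ hs, withDensity_apply _ hs,
    ← lintegral_add_left (by fun_prop), ← lintegral_const_mul _ (by fun_prop)]
  refine lintegral_congr fun z => ?_
  rw [← ENNReal.ofReal_add (hf0 z) (hg0 z), div_eq_inv_mul, ENNReal.ofReal_mul (by norm_num),
    ENNReal.ofReal_inv_of_pos (by norm_num), ENNReal.ofReal_ofNat]

lemma midpoint_mem_couplingDensities {f g : α × α → ℝ} (hf : f ∈ couplingDensities μ ν)
    (hg : g ∈ couplingDensities μ ν) : (fun z => (f z + g z) / 2) ∈ couplingDensities μ ν := by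
  obtain ⟨hfm, hf0, hf1⟩ := hf
  obtain ⟨hgm, hg0, hg1⟩ := hg
  refine ⟨by fun_prop, fun z => by linarith [hf0 z, hg0 z], ?_⟩
  rw [isCoupling_iff_forall] at hf1 hg1 ⊢
  have h2 : ∀ a : ℝ≥0∞, 2⁻¹ * (a + a) = a := fun a => by
    rw [← two_mul, ← mul_assoc, ENNReal.inv_mul_cancel (by simp) (by simp), one_mul]
  constructor
  · intro s hs
    rw [withDensity_midpoint_apply hfm hgm hf0 hg0 (measurable_fst hs), hf1.1 s hs, hg1.1 s hs, h2]
  · intro s hs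
    rw [withDensity_midpoint_apply hfm hgm hf0 hg0 (measurable_snd hs), hf1.2 s hs, hg1.2 s hs, h2]

lemma tendsto_withDensity_of_tendsto_eLpNorm_sqrt {X : Type*} [MeasurableSpace X]
    {π : Measure X} {u : ℕ → X → ℝ} {g : X → ℝ} (hu : ∀ n, Measurable (u n))
    (hu0 : ∀ n x, 0 ≤ u n x) (hg : Measurable g)
    (hlim : Tendsto (fun n => eLpNorm (fun x => √(u n x) - g x) 2 π) atTop (𝓝 0))
    {s : Set X} (hs : MeasurableSet s) :
    Tendsto (fun n => π.withDensity (fun x => ENNReal.ofReal (u n x)) s) atTop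
      (𝓝 (π.withDensity (fun x => ENNReal.ofReal (g x ^ 2)) s)) := by
  have h0 : Tendsto (fun n => eLpNorm (fun x => √(u n x) - g x) 2 (π.restrict s)) atTop (𝓝 0) :=
    tendsto_of_tendsto_of_tendsto_of_le_of_le tendsto_const_nhds hlim (fun _ => zero_le)
      fun n => eLpNorm_mono_measure _ Measure.restrict_le_self
  have h1 : Tendsto (fun n => eLpNorm (fun x => √(u n x)) 2 (π.restrict s)) atTop
      (𝓝 (eLpNorm g 2 (π.restrict s))) := by
    refine tendsto_of_tendsto_of_tendsto_of_le_of_le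
      (g := fun n => eLpNorm g 2 (π.restrict s) -
        eLpNorm (fun x => √(u n x) - g x) 2 (π.restrict s))
      (h := fun n => eLpNorm (fun x => √(u n x) - g x) 2 (π.restrict s) +
        eLpNorm g 2 (π.restrict s)) ?_ ?_ (fun n => ?_) fun n => ?_
    · simpa using ENNReal.Tendsto.sub tendsto_const_nhds h0 (Or.inr ENNReal.zero_ne_top)
    · simpa using h0.add_const (eLpNorm g 2 (π.restrict s))
    · have := hu n
      refine tsub_le_iff_right.2 ?_
      have h := eLpNorm_sub_le (μ := π.restrict s) (p := 2) (f := fun x => √(u n x))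
        (g := fun x => √(u n x) - g x) (by fun_prop) (by fun_prop) one_le_two
      simpa only [Pi.sub_def, sub_sub_cancel] using h
    · have := hu n
      have h := eLpNorm_add_le (μ := π.restrict s) (p := 2) (f := fun x => √(u n x) - g x)
        (g := g) (by fun_prop) (by fun_prop) one_le_two
      simpa only [Pi.add_def, sub_add_cancel] using h
  have h2 := (ENNReal.continuous_pow 2).continuousAt.tendsto.comp h1
  simp only [Function.comp_def, eLpNorm_two_sq, Real.sq_sqrt (hu0 _ _)] at h2
  simpa only [withDensity_apply _ hs] using h2

lemma sq_mem_couplingDensities {u : ℕ → α × α → ℝ} {g : α × α → ℝ}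
    (hu : ∀ n, u n ∈ couplingDensities μ ν) (hg : Measurable g)
    (hlim : Tendsto (fun n => eLpNorm (fun x => √(u n x) - g x) 2 (μ.prod ν)) atTop (𝓝 0)) :
    (fun z => g z ^ 2) ∈ couplingDensities μ ν := by
  refine ⟨by fun_prop, fun z => sq_nonneg _, ?_⟩
  have hT := fun s (hs : MeasurableSet s) => tendsto_withDensity_of_tendsto_eLpNorm_sqrt
    (fun n => (hu n).1) (fun n => (hu n).2.1) hg hlim hs
  rw [isCoupling_iff_forall]
  constructor
  · intro s hs
    refine tendsto_nhds_unique (hT _ (measurable_fst hs)) ?_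
    simp only [(isCoupling_iff_forall.1 (hu _).2.2).1 s hs, tendsto_const_nhds]
  · intro s hs
    refine tendsto_nhds_unique (hT _ (measurable_snd hs)) ?_
    simp only [(isCoupling_iff_forall.1 (hu _).2.2).2 s hs, tendsto_const_nhds]

/-- Among the couplings that are absolutely continuous with respect to `μ ⊗ ν`, the cost
`∫ c dγ + ε KL(γ | μ ⊗ ν)` is minimised. -/
lemma exists_isCoupling_forall_le [IsProbabilityMeasure μ] [IsProbabilityMeasure ν]
    (hc : Measurable c) (hc0 : ∀ z, 0 ≤ c z) (hε : 0 < ε) :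
    ∃ γ : Measure (α × α), IsCoupling γ μ ν ∧ γ ≪ μ.prod ν ∧
      ∀ γ' : Measure (α × α), IsCoupling γ' μ ν → γ' ≪ μ.prod ν →
        costInt c γ + ENNReal.ofReal ε * InformationTheory.klDiv γ (μ.prod ν) ≤
          costInt c γ' + ENNReal.ofReal ε * InformationTheory.klDiv γ' (μ.prod ν) := by
  have hprod : IsCoupling (μ.prod ν) μ ν := by simp [IsCoupling]
  obtain ⟨f, hf, hmin⟩ := exists_forall_densityCost_le (π := μ.prod ν) hc hc0 hε
    (K := couplingDensities μ ν)
    (by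
      obtain ⟨f, hf, -⟩ := hprod.exists_density Measure.AbsolutelyContinuous.rfl
      exact ⟨f, hf⟩)
    (fun f hf => ⟨hf.1, hf.2.1, by
      have := hf.2.2.isProbabilityMeasure
      rw [← setLIntegral_univ, ← withDensity_apply _ MeasurableSet.univ]
      exact measure_ne_top _ _⟩)
    (fun f hf g hg => midpoint_mem_couplingDensities hf hg)
    (fun u g hu hg _ hlim => sq_mem_couplingDensities hu hg hlim)
  refine ⟨_, hf.2.2, withDensity_absolutelyContinuous _ _, fun γ' hγ' hac => ?_⟩
  obtain ⟨f', hf', rfl⟩ := hγ'.exists_density hac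
  rw [← densityCost_eq hc hc0 hε hf, ← densityCost_eq hc hc0 hε hf']
  exact hmin f' hf'

end

lemma costInt_prod_lt_top {E : Type*} [NormedAddCommGroup E] [MeasurableSpace E] [BorelSpace E]
    {μ ν : Measure E} {c : E × E → ℝ} {C : ℝ}
    (hcC : ∀ x y, c (x, y) ≤ C * (‖x‖ ^ 2 + ‖y‖ ^ 2)) (hC : 0 ≤ C) (hμ : IsP2 μ) (hν : IsP2 ν) :
    costInt c (μ.prod ν) < ⊤ := by
  have := hμ.1
  have := hν.1
  have hprod : IsCoupling (μ.prod ν) μ ν := by simp [IsCoupling]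
  calc costInt c (μ.prod ν)
      ≤ ∫⁻ z, ENNReal.ofReal C * ((‖z.1‖₊ : ℝ≥0∞) ^ 2 + (‖z.2‖₊ : ℝ≥0∞) ^ 2) ∂(μ.prod ν) := by
        refine lintegral_mono fun z => (ENNReal.ofReal_le_ofReal (hcC z.1 z.2)).trans_eq ?_
        rw [ENNReal.ofReal_mul hC, ENNReal.ofReal_add (by positivity) (by positivity),
          ENNReal.ofReal_pow (by positivity), ENNReal.ofReal_pow (by positivity),
          ofReal_norm, ofReal_norm]
        rfl
    _ = ENNReal.ofReal C * (M2 μ + M2 ν) := by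
        rw [lintegral_const_mul' _ _ ENNReal.ofReal_ne_top, lintegral_add_left (by fun_prop)]
        congr 2
        · conv_rhs => rw [M2, ← hprod.1]
          exact (lintegral_map (f := fun x => (‖x‖₊ : ℝ≥0∞) ^ 2) (by fun_prop) measurable_fst).symm
        · conv_rhs => rw [M2, ← hprod.2]
          exact (lintegral_map (f := fun x => (‖x‖₊ : ℝ≥0∞) ^ 2) (by fun_prop) measurable_snd).symm
    _ < ⊤ := ENNReal.mul_lt_top ENNReal.ofReal_lt_top (ENNReal.add_lt_top.2 ⟨hμ.2, hν.2⟩)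

/-- Lemma 5.5, existence of minimising couplings in the entropic optimal
transport problem. For a continuous cost with `0 ≤ c(x,y) ≤ C₁(‖x‖² + ‖y‖²)` and
`μ, ν ∈ 𝒫₂^r(ℝ^d)` with finite entropy, `W_{c,ε}(μ,ν) < ∞` and the infimum is attained by
an absolutely continuous coupling `γ ∈ Π^r(μ,ν)`. -/
theorem statement_3
    (d : ℕ) (c : Euc d × Euc d → ℝ) (C₁ ε : ℝ) (hC₁ : 0 < C₁) (hε : 0 < ε)
    (hccont : Continuous c)
    (hcbound : ∀ x y : Euc d, 0 ≤ c (x, y) ∧ c (x, y) ≤ C₁ * (‖x‖ ^ 2 + ‖y‖ ^ 2))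
    (μ ν : Measure (Euc d)) (hμ : IsP2r μ) (hν : IsP2r ν)
    (hHμ : entropy μ < ⊤) (hHν : entropy ν < ⊤) :
    transportCost c ε μ ν < ⊤ ∧
      ∃ γ : Measure (Euc d × Euc d), IsCoupling γ μ ν ∧
        γ ≪ (volume : Measure (Euc d × Euc d)) ∧
        transportCost c ε μ ν = (costInt c γ : EReal) + (ε : EReal) * entropy γ := by
  have hc0 : ∀ z, 0 ≤ c z := fun z => (hcbound z.1 z.2).1
  obtain ⟨⟨hμp, hμM⟩, hμac⟩ := hμ
  obtain ⟨⟨hνp, hνM⟩, hνac⟩ := hν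
  have hπac : μ.prod ν ≪ (volume : Measure (Euc d × Euc d)) := hμac.prod hνac
  have hobj : ∀ γ : Measure (Euc d × Euc d), IsCoupling γ μ ν → γ ≪ volume →
      (costInt c γ : EReal) + (ε : EReal) * entropy γ =
        ((costInt c γ + ENNReal.ofReal ε * InformationTheory.klDiv γ (μ.prod ν) : ℝ≥0∞) : EReal) +
        ((ε * (∫ x, Real.log (dens μ x) ∂μ + ∫ x, Real.log (dens ν x) ∂ν) : ℝ) : EReal) :=
    fun γ hγ hac => by
      rw [hγ.entropy_eq hμac hνac hHμ hHν hac, coe_add_mul_coe_add _ _ hε]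
  have hle : ∀ γ : Measure (Euc d × Euc d), IsCoupling γ μ ν →
      transportCost c ε μ ν ≤ (costInt c γ : EReal) + (ε : EReal) * entropy γ :=
    fun γ hγ => iInf₂_le γ hγ
  constructor
  · have hprod : IsCoupling (μ.prod ν) μ ν := by simp [IsCoupling]
    refine (hle _ hprod).trans_lt ?_
    rw [hobj _ hprod hπac, InformationTheory.klDiv_self, mul_zero, add_zero]
    refine EReal.add_lt_top ?_ (EReal.coe_ne_top _)
    rw [ne_eq, EReal.coe_ennreal_eq_top_iff]
    exact (costInt_prod_lt_top (fun x y => (hcbound x y).2) hC₁.le ⟨hμp, hμM⟩ ⟨hνp, hνM⟩).ne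
  · obtain ⟨γ, hγ, hγπ, hmin⟩ :=
      exists_isCoupling_forall_le (μ := μ) (ν := ν) hccont.measurable hc0 hε
    have hac := hγπ.trans hπac
    refine ⟨γ, hγ, hac, le_antisymm (hle γ hγ) (le_iInf₂ fun γ' hγ' => ?_)⟩
    by_cases hac' : γ' ≪ volume
    · rw [hobj γ hγ hac, hobj γ' hγ' hac']
      gcongr
      exact_mod_cast hmin γ' hγ' (IsCoupling.absolutelyContinuous_prod hμac hνac hγ' hac')
    · rw [entropy.eq_def γ', if_neg fun h => hac' h.1, EReal.coe_mul_top_of_pos hε,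
        EReal.add_top_of_ne_bot (by simp)]
      exact le_top
end
end
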